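/- Let n ≥ 3 and ℓ ≥ n+1, and let G_1,...,G_ℓ be graphs such that each G_j: (a) has the same number of vertices, at least 4n−2; (b) is bipartite and equitable with partite sets V_{j,1}, V_{j,2}; (c) admits an (n−1)-PDPC for every choice of (n−1)-subsets S_j ⊆ V_{j,1} and T_j ⊆ V_{j,2}. Let G be a weld of G_1,...,G_ℓ that is bipartite with partite sets V_1 and V_2. Then for every choice of n-subsets S ⊆ V_1 and T ⊆ V_2, G admits an n-PDPC. -/

import Mathlib

open Finset

/-- A paired `k`-PDPC of `G` with prescribed endpoints `s i`, `t i`. -/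
def IsPDPC {V : Type} [Fintype V] (G : SimpleGraph V) {k : ℕ} (s t : Fin k → V) : Prop :=
  ∃ P : (i : Fin k) → G.Walk (s i) (t i),
    (∀ i, (P i).IsPath) ∧
    (∀ i j, i ≠ j → ∀ v, v ∈ (P i).support → v ∉ (P j).support) ∧
    (∀ v : V, ∃ i, v ∈ (P i).support)

/-- `V1, V2` form a bipartition of `G` into partite sets. -/
def IsBipartition {V : Type} (G : SimpleGraph V) (V1 V2 : Finset V) : Prop :=
  (∀ v, v ∈ V1 ∨ v ∈ V2) ∧ (∀ v, ¬(v ∈ V1 ∧ v ∈ V2)) ∧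
  (∀ ⦃u v⦄, G.Adj u v → (u ∈ V1 ∧ v ∈ V2) ∨ (u ∈ V2 ∧ v ∈ V1))

/-- `G` on `Fin ℓ × W` is a weld of the graphs `Gs i`: each layer `i` is a copy of `Gs i`
and between any two distinct layers the edges of `G` form a perfect matching. -/
def IsWeld {ℓ : ℕ} {W : Type} (G : SimpleGraph (Fin ℓ × W)) (Gs : Fin ℓ → SimpleGraph W) : Prop :=
  (∀ i u v, G.Adj (i, u) (i, v) ↔ (Gs i).Adj u v) ∧
  (∀ i j, i ≠ j → ∃ f : W ≃ W, ∀ u v, G.Adj (i, u) (j, v) ↔ v = f u)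

/-- `G` has a path from `a` to `b` whose vertex set is `X`. -/
inductive Link {V : Type} (G : SimpleGraph V) : V → V → Set V → Prop
  | single (a : V) : Link G a a {a}
  | cons {a b c : V} {X : Set V} : G.Adj a c → Link G c b X → a ∉ X → Link G a b (insert a X)

namespace Link

variable {V : Type} {G : SimpleGraph V} {a b c d v : V} {X Y : Set V}

lemma left_mem (h : Link G a b X) : a ∈ X := by
  cases h <;> simp

lemma right_mem (h : Link G a b X) : b ∈ X := by
  induction h with
  | single => simp
  | cons _ _ _ ih => exact Or.inr ih

lemma append (h : Link G a b X) (e : G.Adj b c) (h' : Link G c d Y) (hd : Disjoint X Y) :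
    Link G a d (X ∪ Y) := by
  induction h with
  | single x =>
    rw [Set.singleton_union]
    exact .cons e h' (by simpa using hd)
  | cons e1 h1 hn ih =>
    rw [Set.insert_union]
    rw [Set.disjoint_insert_left] at hd
    exact .cons e1 (ih e hd.2) (by simp [hn, hd.1])

lemma symm (h : Link G a b X) : Link G b a X := by
  induction h with
  | single x => exact .single x
  | @cons x _ _ Y e h1 hn ih =>
    have := ih.append e.symm (.single x) (by simpa using hn)
    rwa [Set.union_singleton] at this

lemma split_before (h : Link G a b X) (hv : v ∈ X) (hva : v ≠ a) :
    ∃ u X₁ X₂, Link G a u X₁ ∧ G.Adj u v ∧ Link G v b X₂ ∧ Disjoint X₁ X₂ ∧ X = X₁ ∪ X₂ := by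
  induction h with
  | single x => exact absurd hv hva
  | @cons x y z Y e h1 hn ih =>
    have hvY : v ∈ Y := hv.resolve_left hva
    by_cases hvz : v = z
    · subst hvz
      exact ⟨x, {x}, Y, .single x, e, h1, by simpa using hn, by simp⟩
    · obtain ⟨u, X₁, X₂, l1, e1, l2, hd, rfl⟩ := ih hvY hvz
      simp only [Set.mem_union, not_or] at hn
      exact ⟨u, insert x X₁, X₂, .cons e l1 hn.1, e1, l2, by simp [hd, hn.2],
        by rw [Set.insert_union]⟩

lemma split_after (h : Link G a b X) (hv : v ∈ X) (hvb : v ≠ b) :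
    ∃ u X₁ X₂, Link G a v X₁ ∧ G.Adj v u ∧ Link G u b X₂ ∧ Disjoint X₁ X₂ ∧ X = X₁ ∪ X₂ := by
  obtain ⟨u, X₁, X₂, l1, e1, l2, hd, rfl⟩ := h.symm.split_before hv hvb
  exact ⟨u, X₂, X₁, l2.symm, e1.symm, l1.symm, hd.symm, Set.union_comm _ _⟩

lemma split_mid (h : Link G a b X) (hv : v ∈ X) (hva : v ≠ a) (hvb : v ≠ b) :
    ∃ x y X₁ X₂ X₃, Link G a x X₁ ∧ G.Adj x v ∧ Link G v v X₂ ∧ G.Adj v y ∧ Link G y b X₃ ∧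
      Disjoint X₁ X₂ ∧ Disjoint X₁ X₃ ∧ Disjoint X₂ X₃ ∧ X = X₁ ∪ X₂ ∪ X₃ := by
  obtain ⟨x, X₁, Z, l1, e1, l2, hd, rfl⟩ := h.split_before hv hva
  obtain ⟨y, X₂, X₃, l3, e2, l4, hd', rfl⟩ := l2.split_after l2.left_mem hvb
  rw [Set.disjoint_union_right] at hd
  exact ⟨x, y, X₁, X₂, X₃, l1, e1, l3, e2, l4, hd.1, hd.2, hd', by rw [Set.union_assoc]⟩

/-- Two inner vertices of a path cut it into three consecutive paths. -/
lemma split_two {s t : V} (h : Link G a b X) (hs : s ∈ X) (ht : t ∈ X)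
    (hsa : s ≠ a) (hsb : s ≠ b) (hta : t ≠ a) (htb : t ≠ b) :
    ∃ x z X₁ X₂ X₃, Link G a x X₁ ∧ Link G s t X₂ ∧ Link G z b X₃ ∧
      (G.Adj x s ∧ G.Adj t z ∨ G.Adj x t ∧ G.Adj s z) ∧
      Disjoint X₁ X₂ ∧ Disjoint X₁ X₃ ∧ Disjoint X₂ X₃ ∧ X = X₁ ∪ X₂ ∪ X₃ := by
  obtain ⟨x, X₁, Z, l1, e1, l2, hd, rfl⟩ := h.split_before hs hsa
  rcases ht with ht | ht
  · obtain ⟨y, Y₁, Y₂, m1, f1, m2, hd', rfl⟩ := l1.split_before ht hta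
    obtain ⟨z, Z₁, Z₂, m3, f3, m4, hd'', rfl⟩ := l2.split_after l2.left_mem hsb
    simp only [Set.disjoint_union_right, Set.disjoint_union_left] at hd
    refine ⟨y, z, Y₁, Y₂ ∪ Z₁, Z₂, m1, (m2.append e1 m3 hd.1.2).symm, m4, Or.inr ⟨f1, f3⟩,
      ?_, hd.2.1, ?_, ?_⟩
    · simp [Set.disjoint_union_right, hd', hd.1.1]
    · simp [Set.disjoint_union_left, hd'', hd.2.2]
    · simp only [Set.union_assoc]
  · obtain ⟨z, Z₁, Z₂, m3, f3, m4, hd'', rfl⟩ := l2.split_after ht htb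
    rw [Set.disjoint_union_right] at hd
    exact ⟨x, z, X₁, Z₁, Z₂, l1, m3, m4, Or.inl ⟨e1, f3⟩, hd.1, hd.2, hd'',
      by rw [Set.union_assoc]⟩

lemma exists_walk (h : Link G a b X) :
    ∃ p : G.Walk a b, p.IsPath ∧ ∀ v, v ∈ p.support ↔ v ∈ X := by
  induction h with
  | single x => exact ⟨.nil, by simp, by simp⟩
  | cons e _ hn ih =>
    obtain ⟨p, hp, hs⟩ := ih
    exact ⟨.cons e p, by simp [hp, hs, hn], by simp [hs]⟩

lemma of_walk (p : G.Walk a b) (hp : p.IsPath) : Link G a b {v | v ∈ p.support} := by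
  induction p with
  | nil => simpa using Link.single _
  | cons e q ih =>
    rw [SimpleGraph.Walk.cons_isPath_iff] at hp
    have := Link.cons e (ih hp.1) hp.2
    convert this using 1
    ext v; simp

lemma map {V' : Type} {G' : SimpleGraph V'} (f : V → V') (hf : Function.Injective f)
    (hadj : ∀ u v, G.Adj u v → G'.Adj (f u) (f v)) (h : Link G a b X) :
    Link G' (f a) (f b) (f '' X) := by
  induction h with
  | single x => simpa using Link.single _
  | cons e _ hn ih =>
    rw [Set.image_insert_eq]
    exact .cons (hadj _ _ e) ih (by simpa [hf.eq_iff] using hn)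

end Link

/-- The paths with endpoints `a i`, `b i` for `i ∈ J` can be chosen to partition `U`. -/
def Cover {V ι : Type} (G : SimpleGraph V) (U : Set V) (J : Finset ι) (a b : ι → V) : Prop :=
  ∃ X : ι → Set V, (∀ i ∈ J, Link G (a i) (b i) (X i)) ∧
    (∀ i ∈ J, ∀ j ∈ J, i ≠ j → Disjoint (X i) (X j)) ∧ ∀ v, v ∈ U ↔ ∃ i ∈ J, v ∈ X i

namespace Cover

variable {V ι : Type} {G : SimpleGraph V} {U U₁ U₂ X : Set V} {J J₁ J₂ : Finset ι}
  {a b a' b' u v : ι → V}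

lemma congr (h : Cover G U J a b) (ha : ∀ i ∈ J, a i = a' i) (hb : ∀ i ∈ J, b i = b' i) :
    Cover G U J a' b' := by
  obtain ⟨X, h1, h2, h3⟩ := h
  exact ⟨X, fun i hi => ha i hi ▸ hb i hi ▸ h1 i hi, h2, h3⟩

lemma peel_aux [DecidableEq ι] {X : ι → Set V} (h1 : ∀ i ∈ J, Link G (a i) (b i) (X i))
    (h2 : ∀ i ∈ J, ∀ j ∈ J, i ≠ j → Disjoint (X i) (X j)) (h3 : ∀ v, v ∈ U ↔ ∃ i ∈ J, v ∈ X i)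
    {i : ι} (hi : i ∈ J) :
    ∃ U', Cover G U' (J.erase i) a b ∧ Disjoint U' (X i) ∧ U = U' ∪ X i := by
  refine ⟨{v | ∃ j ∈ J.erase i, v ∈ X j}, ⟨X, ?_, ?_, ?_⟩, ?_, ?_⟩
  · exact fun j hj => h1 j (Finset.mem_of_mem_erase hj)
  · exact fun j hj k hk => h2 j (Finset.mem_of_mem_erase hj) k (Finset.mem_of_mem_erase hk)
  · simp
  · rw [Set.disjoint_left]
    rintro v ⟨j, hj, hv⟩ hv'
    exact Set.disjoint_left.1
      (h2 j (Finset.mem_of_mem_erase hj) i hi (Finset.ne_of_mem_erase hj)) hv hv'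
  · ext v
    rw [h3]
    constructor
    · rintro ⟨j, hj, hv⟩
      by_cases hji : j = i
      · exact Or.inr (hji ▸ hv)
      · exact Or.inl ⟨j, Finset.mem_erase.2 ⟨hji, hj⟩, hv⟩
    · rintro (⟨j, hj, hv⟩ | hv)
      · exact ⟨j, Finset.mem_of_mem_erase hj, hv⟩
      · exact ⟨i, hi, hv⟩

/-- Remove the path with a given index from a cover. -/
lemma peel [DecidableEq ι] (h : Cover G U J a b) {i : ι} (hi : i ∈ J) :
    ∃ X U', Link G (a i) (b i) X ∧ Cover G U' (J.erase i) a b ∧ Disjoint U' X ∧ U = U' ∪ X := by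
  obtain ⟨X, h1, h2, h3⟩ := h
  obtain ⟨U', h⟩ := peel_aux h1 h2 h3 hi
  exact ⟨X i, U', h1 i hi, h⟩

/-- Remove the path through a given vertex from a cover. -/
lemma peel_mem [DecidableEq ι] (h : Cover G U J a b) {v : V} (hv : v ∈ U) :
    ∃ i ∈ J, ∃ X U', v ∈ X ∧ Link G (a i) (b i) X ∧ Cover G U' (J.erase i) a b ∧
      Disjoint U' X ∧ U = U' ∪ X := by
  obtain ⟨X, h1, h2, h3⟩ := h
  obtain ⟨i, hi, hvi⟩ := (h3 v).1 hv
  obtain ⟨U', h⟩ := peel_aux h1 h2 h3 hi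
  exact ⟨i, hi, X i, U', hvi, h1 i hi, h⟩

lemma insert [DecidableEq ι] (h : Cover G U J a b) {i : ι} (hl : Link G (a i) (b i) X)
    (hi : i ∉ J) (hd : Disjoint U X) : Cover G (U ∪ X) (insert i J) a b := by
  obtain ⟨Y, h1, h2, h3⟩ := h
  have hY : ∀ j ∈ J, Disjoint (Y j) X := fun j hj =>
    hd.mono_left fun v hv => (h3 v).2 ⟨j, hj, hv⟩
  have hne : ∀ j ∈ J, j ≠ i := fun j hj h => hi (h ▸ hj)
  refine ⟨fun j => if j = i then X else Y j, ?_, ?_, ?_⟩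
  · intro j hj
    rcases Finset.mem_insert.1 hj with rfl | hj
    · simpa using hl
    · simpa [hne j hj] using h1 j hj
  · intro j hj k hk hjk
    rcases Finset.mem_insert.1 hj with hji | hj' <;> rcases Finset.mem_insert.1 hk with hki | hk'
    · exact absurd (hji.trans hki.symm) hjk
    · simpa [hji, hne k hk'] using (hY k hk').symm
    · simpa [hki, hne j hj'] using hY j hj'
    · simpa [hne k hk', hne j hj'] using h2 j hj' k hk' hjk
  · intro v
    rw [Set.mem_union, h3]
    constructor
    · rintro (⟨j, hj, hv⟩ | hv)
      · exact ⟨j, Finset.mem_insert_of_mem hj, by simpa [hne j hj] using hv⟩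
      · exact ⟨i, Finset.mem_insert_self _ _, by simpa using hv⟩
    · rintro ⟨j, hj, hv⟩
      rcases Finset.mem_insert.1 hj with rfl | hj
      · exact Or.inr (by simpa using hv)
      · exact Or.inl ⟨j, hj, by simpa [hne j hj] using hv⟩

/-- Concatenate the paths of two covers of disjoint sets. -/
lemma join (h₁ : Cover G U₁ J₁ a u) (h₂ : Cover G U₂ J₂ v b) (hJ : J₂ ⊆ J₁)
    (hd : Disjoint U₁ U₂) (hadj : ∀ i ∈ J₂, G.Adj (u i) (v i))
    (heq : ∀ i ∈ J₁, i ∉ J₂ → u i = b i) : Cover G (U₁ ∪ U₂) J₁ a b := by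
  classical
  obtain ⟨X, x1, x2, x3⟩ := h₁
  obtain ⟨Y, y1, y2, y3⟩ := h₂
  have hXY : ∀ i ∈ J₁, ∀ j ∈ J₂, Disjoint (X i) (Y j) := fun i hi j hj =>
    hd.mono (fun v hv => (x3 v).2 ⟨i, hi, hv⟩) (fun v hv => (y3 v).2 ⟨j, hj, hv⟩)
  refine ⟨fun i => if i ∈ J₂ then X i ∪ Y i else X i, ?_, ?_, ?_⟩
  · intro i hi
    by_cases h : i ∈ J₂
    · simpa [h] using (x1 i hi).append (hadj i h) (y1 i h) (hXY i hi i h)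
    · simpa [h, heq i hi h] using x1 i hi
  · intro i hi j hj hij
    have := x2 i hi j hj hij
    by_cases h : i ∈ J₂ <;> by_cases h' : j ∈ J₂ <;>
      simp only [h, h', if_true, if_false, Set.disjoint_union_left, Set.disjoint_union_right]
    · exact ⟨⟨this, (hXY j hj i h).symm⟩, hXY i hi j h', y2 i h j h' hij⟩
    · exact ⟨this, (hXY j hj i h).symm⟩
    · exact ⟨this, hXY i hi j h'⟩
    · exact this
  · intro w
    rw [Set.mem_union, x3, y3]
    constructor
    · rintro (⟨j, hj, hv⟩ | ⟨j, hj, hv⟩)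
      · refine ⟨j, hj, ?_⟩
        dsimp only
        split_ifs
        · exact Or.inl hv
        · exact hv
      · exact ⟨j, hJ hj, by simp [hj, hv]⟩
    · rintro ⟨j, hj, hv⟩
      dsimp only at hv
      split_ifs at hv with h
      · rcases hv with hv | hv
        · exact Or.inl ⟨j, hj, hv⟩
        · exact Or.inr ⟨j, h, hv⟩
      · exact Or.inl ⟨j, hj, hv⟩

/-- Reverse some of the paths. -/
lemma swap (h : Cover G U J a b)
    (hs : ∀ i ∈ J, a' i = a i ∧ b' i = b i ∨ a' i = b i ∧ b' i = a i) : Cover G U J a' b' := by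
  obtain ⟨X, h1, h2, h3⟩ := h
  refine ⟨X, fun i hi => ?_, h2, h3⟩
  rcases hs i hi with ⟨e, e'⟩ | ⟨e, e'⟩ <;> rw [e, e']
  · exact h1 i hi
  · exact (h1 i hi).symm

/-- Concatenate the paths with indices `some i` and `none`. -/
lemma option [DecidableEq ι] {i : ι} {x y : V}
    (h : Cover G U (Finset.insertNone J) (fun o => o.elim y a)
      (fun o => o.elim (b i) (Function.update b i x))) (hxy : G.Adj x y) (hi : i ∈ J) :
    Cover G U J a b := by
  obtain ⟨X, h1, h2, h3⟩ := h
  have hn := Finset.none_mem_insertNone (s := J)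
  have hso : ∀ j ∈ J, some j ∈ Finset.insertNone J := fun j hj => Finset.some_mem_insertNone.2 hj
  refine ⟨fun j => if j = i then X (some i) ∪ X none else X (some j), ?_, ?_, ?_⟩
  · intro j hj
    by_cases hji : j = i
    · subst hji
      have l1 := h1 _ (hso j hj)
      have l2 := h1 _ hn
      simp only [Option.elim_some, Option.elim_none, Function.update_self] at l1 l2
      simpa using l1.append hxy l2 (h2 _ (hso j hj) _ hn (by simp))
    · simpa [hji] using h1 _ (hso j hj)
  · intro j hj k hk hjk
    have hs := h2 _ (hso j hj) _ (hso k hk) (by simpa using hjk)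
    have hj' := h2 _ (hso j hj) _ hn (by simp)
    have hk' := h2 _ (hso k hk) _ hn (by simp)
    by_cases h : j = i
    · have h' : k ≠ i := fun h' => hjk (h.trans h'.symm)
      subst h
      simp [h', hs, hk'.symm]
    · by_cases h' : k = i
      · subst h'
        simp [h, hs, hj']
      · simpa [h, h'] using hs
  · intro w
    rw [h3]
    constructor
    · rintro ⟨o, ho, hw⟩
      cases o with
      | none => exact ⟨i, hi, by simp [hw]⟩
      | some j =>
        refine ⟨j, Finset.some_mem_insertNone.1 ho, ?_⟩
        by_cases h : j = i
        · subst h; simp [hw]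
        · simpa [h] using hw
    · rintro ⟨j, hj, hw⟩
      by_cases h : j = i
      · subst h
        simp only [if_true] at hw
        exact hw.elim (fun hw => ⟨_, hso j hj, hw⟩) (fun hw => ⟨_, hn, hw⟩)
      · exact ⟨_, hso j hj, by simpa [h] using hw⟩

end Cover

/-- The pairs `a i`, `b i` for `i ∈ J` are pairwise disjoint and each consists of two vertices of
different colours. -/
def Admissible {V ι : Type} (col : V → Bool) (J : Finset ι) (a b : ι → V) : Prop :=
  (∀ i ∈ J, col (a i) ≠ col (b i)) ∧
    ∀ i ∈ J, ∀ j ∈ J, i ≠ j → a i ≠ a j ∧ b i ≠ b j ∧ a i ≠ b j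

namespace Admissible

variable {V ι : Type} {col : V → Bool} {J J' : Finset ι} {a b a' b' : ι → V}

lemma mono (h : Admissible col J a b) (hJ : J' ⊆ J) : Admissible col J' a b :=
  ⟨fun i hi => h.1 i (hJ hi), fun i hi j hj => h.2 i (hJ hi) j (hJ hj)⟩

lemma ne (h : Admissible col J a b) {i j : ι} (hi : i ∈ J) (hj : j ∈ J) : a i ≠ b j := by
  by_cases hij : i = j
  · subst hij
    exact fun e => h.1 i hi (congrArg col e)
  · exact (h.2 i hi j hj hij).2.2

lemma option [DecidableEq ι] (h : Admissible col J a b) {i : ι} {x y : V} (hi : i ∈ J)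
    (hx : col x ≠ col (a i)) (hxy : col x ≠ col y)
    (hx' : ∀ j ∈ J, x ≠ a j ∧ x ≠ b j) (hy' : ∀ j ∈ J, y ≠ a j ∧ y ≠ b j) :
    Admissible col (Finset.insertNone J) (fun o => o.elim y a)
      (fun o => o.elim (b i) (Function.update b i x)) := by
  have hne : x ≠ y := fun e => hxy (congrArg col e)
  have hy : col y ≠ col (b i) := by
    have := h.1 i hi
    revert this hx hxy
    cases col x <;> cases col y <;> cases col (a i) <;> cases col (b i) <;> simp
  refine ⟨?_, ?_⟩
  · rintro (_ | j) hj
    · simpa using hy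
    · have hj' := Finset.some_mem_insertNone.1 hj
      by_cases hji : j = i
      · subst hji; simpa using hx.symm
      · simpa [hji] using h.1 j hj'
  · rintro (_ | j) hj (_ | k) hk hjk
    · exact absurd rfl hjk
    · have hk' := Finset.some_mem_insertNone.1 hk
      by_cases hki : k = i
      · subst hki
        simpa using ⟨(hy' k hk').1, (hx' k hk').2.symm, hne.symm⟩
      · have := h.2 i hi k hk' (Ne.symm hki)
        simpa [hki] using ⟨(hy' k hk').1, this.2.1, (hy' k hk').2⟩
    · have hj' := Finset.some_mem_insertNone.1 hj
      have h1 := h.ne hj' hi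
      by_cases hji : j = i
      · subst hji
        simpa using ⟨(hy' j hj').1.symm, (hx' j hj').2, h1⟩
      · have := h.2 i hi j hj' (Ne.symm hji)
        simpa [hji] using ⟨(hy' j hj').1.symm, this.2.1.symm, h1⟩
    · have hj' := Finset.some_mem_insertNone.1 hj
      have hk' := Finset.some_mem_insertNone.1 hk
      have hjk' : j ≠ k := fun e => hjk (congrArg some e)
      have := h.2 j hj' k hk' hjk'
      by_cases hji : j = i <;> by_cases hki : k = i
      · exact absurd (hji.trans hki.symm) hjk'
      · subst hji
        simpa [hki] using ⟨this.1, (hx' k hk').2, this.2.2⟩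
      · subst hki
        simpa [hji] using ⟨this.1, (hx' j hj').2.symm, (hx' j hj').1.symm⟩
      · simpa [hji, hki] using this

end Admissible

/-- A graph whose vertices are properly 2-coloured by `col` and distributed over layers by `lay`;
`mv p v` is the vertex of layer `p` matched to `v`. -/
structure Layered {V L : Type} (G : SimpleGraph V) (lay : V → L) (col : V → Bool)
    (mv : L → V → V) (n : ℕ) : Prop where
  col_adj : ∀ {u v}, G.Adj u v → col u ≠ col v
  lay_mv : ∀ {p v}, lay v ≠ p → lay (mv p v) = p
  adj_mv : ∀ {p v}, lay v ≠ p → G.Adj v (mv p v)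
  mv_mv : ∀ {p v}, lay v ≠ p → mv (lay v) (mv p v) = v
  exists_notMem : ∀ p c, ∀ F : Finset V, F.card ≤ 2 * n - 2 → ∃ v, lay v = p ∧ col v = c ∧ v ∉ F
  cover : ∀ p, ∀ a b : Fin (n - 1) → V, Admissible col Finset.univ a b →
    (∀ i, lay (a i) = p) → (∀ i, lay (b i) = p) → Cover G {v | lay v = p} Finset.univ a b

namespace Layered

variable {V L : Type} {G : SimpleGraph V} {lay : V → L} {col : V → Bool} {mv : L → V → V} {n : ℕ}

lemma col_mv (H : Layered G lay col mv n) {p : L} {v : V} (h : lay v ≠ p) :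
    col (mv p v) = !col v := by
  have := H.col_adj (H.adj_mv h)
  revert this
  cases col v <;> cases col (mv p v) <;> simp

lemma mv_inj (H : Layered G lay col mv n) {p : L} {u v : V} (hu : lay u ≠ p)
    (huv : lay u = lay v) (h : mv p u = mv p v) : u = v := by
  rw [← H.mv_mv hu, ← H.mv_mv (p := p) (v := v) (huv ▸ hu), huv, h]

/-- A layer admits covers with every number of paths between `1` and `n - 1`. -/
lemma cover_layer (H : Layered G lay col mv n) (p : L) {ι : Type} (J : Finset ι)
    (hJ : J.Nonempty) (hc : J.card ≤ n - 1) (a b : ι → V) (hab : Admissible col J a b)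
    (ha : ∀ i ∈ J, lay (a i) = p) (hb : ∀ i ∈ J, lay (b i) = p) :
    Cover G {v | lay v = p} J a b := by
  classical
  induction hd : n - 1 - J.card generalizing ι with
  | zero =>
    have hc' : J.card = n - 1 := by omega
    let e := (J.equivFinOfCardEq hc').symm
    obtain ⟨X, h1, h2, h3⟩ := H.cover p (fun i => a (e i)) (fun i => b (e i))
      ⟨fun i _ => hab.1 _ (e i).2, fun i _ j _ hij => hab.2 _ (e i).2 _ (e j).2
        fun h => hij (e.injective (Subtype.ext h))⟩
      (fun i => ha _ (e i).2) (fun i => hb _ (e i).2)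
    refine ⟨fun j => if h : j ∈ J then X (e.symm ⟨j, h⟩) else ∅, ?_, ?_, ?_⟩
    · intro i hi
      simpa [hi] using h1 (e.symm ⟨i, hi⟩) (Finset.mem_univ _)
    · intro i hi j hj hij
      simpa [hi, hj] using h2 (e.symm ⟨i, hi⟩) (Finset.mem_univ _) (e.symm ⟨j, hj⟩)
        (Finset.mem_univ _) (by simpa using hij)
    · intro v
      rw [h3]
      constructor
      · rintro ⟨i, -, hv⟩
        exact ⟨e i, (e i).2, by simpa using hv⟩
      · rintro ⟨i, hi, hv⟩
        exact ⟨e.symm ⟨i, hi⟩, Finset.mem_univ _, by simpa [hi] using hv⟩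
  | succ d ih =>
    obtain ⟨i, hi⟩ := hJ
    have hF : (J.image a ∪ J.image b).card ≤ 2 * n - 2 := by
      have h1 := Finset.card_union_le (J.image a) (J.image b)
      have h2 := Finset.card_image_le (s := J) (f := a)
      have h3 := Finset.card_image_le (s := J) (f := b)
      omega
    obtain ⟨x, hxp, hxc, hxF⟩ := H.exists_notMem p (!col (a i)) _ hF
    obtain ⟨y, hyp, hyc, hyF⟩ := H.exists_notMem p (col (a i)) _ hF
    have hx : ∀ j ∈ J, x ≠ a j ∧ x ≠ b j := fun j hj =>
      ⟨fun h => hxF (by simp [h, Finset.mem_image_of_mem a hj]),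
        fun h => hxF (by simp [h, Finset.mem_image_of_mem b hj])⟩
    have hy : ∀ j ∈ J, y ≠ a j ∧ y ≠ b j := fun j hj =>
      ⟨fun h => hyF (by simp [h, Finset.mem_image_of_mem a hj]),
        fun h => hyF (by simp [h, Finset.mem_image_of_mem b hj])⟩
    have hxy : col x ≠ col y := by simp [hxc, hyc]
    have hcard : (Finset.insertNone J).card = J.card + 1 := Finset.card_insertNone J
    obtain ⟨X, h1, h2, h3⟩ := ih (Finset.insertNone J) ⟨none, by simp⟩ (by omega)
      (fun o => o.elim x a) (fun o => o.elim y b)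
      (by
        refine ⟨?_, ?_⟩
        · rintro (_ | j) hj
          · exact hxy
          · exact hab.1 j (Finset.some_mem_insertNone.1 hj)
        · rintro (_ | j) hj (_ | k) hk hjk
          · exact absurd rfl hjk
          · have hk' := Finset.some_mem_insertNone.1 hk
            exact ⟨(hx k hk').1, (hy k hk').2, (hx k hk').2⟩
          · have hj' := Finset.some_mem_insertNone.1 hj
            exact ⟨(hx j hj').1.symm, (hy j hj').2.symm, (hy j hj').1.symm⟩
          · exact hab.2 j (Finset.some_mem_insertNone.1 hj) k (Finset.some_mem_insertNone.1 hk)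
              fun e => hjk (congrArg some e))
      (by rintro (_ | j) hj
          · exact hxp
          · exact ha j (Finset.some_mem_insertNone.1 hj))
      (by rintro (_ | j) hj
          · exact hyp
          · exact hb j (Finset.some_mem_insertNone.1 hj)) (by omega)
    have hn := Finset.none_mem_insertNone (s := J)
    have l0 := h1 _ hn
    simp only [Option.elim_none] at l0
    obtain ⟨z, X₁, X₂, -, e, l2, -, hX⟩ :=
      l0.split_after l0.left_mem (fun h => hxy (congrArg col h))
    have hz0 : z ∈ X none := hX ▸ Or.inr l2.left_mem
    have hz : ∀ j ∈ J, z ≠ a j ∧ z ≠ b j := by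
      intro j hj
      have hj' : some j ∈ Finset.insertNone J := Finset.some_mem_insertNone.2 hj
      have l := h1 _ hj'
      have hd := Set.disjoint_left.1 (h2 _ hn _ hj' (by simp)) hz0
      exact ⟨fun h => hd (h ▸ l.left_mem), fun h => hd (h ▸ l.right_mem)⟩
    have hxz := H.col_adj e
    refine Cover.option (ih (Finset.insertNone J) ⟨none, by simp⟩ (by omega) _ _
      (hab.option hi (by simp [hxc]) hxz hx hz) ?_ ?_ (by omega)) e hi
    · rintro (_ | j) hj
      · exact (h3 z).2 ⟨_, hn, hz0⟩
      · exact ha j (Finset.some_mem_insertNone.1 hj)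
    · rintro (_ | j) hj
      · exact hb i hi
      · by_cases hji : j = i
        · subst hji; simpa using hxp
        · simpa [hji] using hb j (Finset.some_mem_insertNone.1 hj)

lemma link_layer (H : Layered G lay col mv n) (hn : 2 ≤ n) {u v : V} (huv : lay u = lay v)
    (hc : col u ≠ col v) : Link G u v {w | lay w = lay u} := by
  obtain ⟨X, h1, -, h3⟩ := H.cover_layer (lay u) (Finset.univ : Finset Unit) (by simp)
    (by simp; omega) (fun _ => u) (fun _ => v) ⟨by simpa using hc, by simp⟩ (by simp)
    (by simp [huv])
  have : {w | lay w = lay u} = X () := by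
    ext w; rw [h3]; exact ⟨fun ⟨_, _, h⟩ => h, fun h => ⟨(), Finset.mem_univ _, h⟩⟩
  rw [this]
  exact h1 () (by simp)

/-- Partition a layer into a path between `c` and `d` and a path starting in `e`. -/
lemma exists_two_links (H : Layered G lay col mv n) (hn : 2 ≤ n) {p : L} {c d e : V}
    (hc : lay c = p) (hd : lay d = p) (he : lay e = p) (hcd : col c = col d)
    (hce : col c ≠ col e) : ∃ w Y₁ Y₂, Link G c d Y₁ ∧ Link G e w Y₂ ∧ Disjoint Y₁ Y₂ ∧
      {v | lay v = p} = Y₁ ∪ Y₂ ∧ lay w = p ∧ col w = col e := by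
  subst hc
  have l := H.link_layer hn he.symm hce
  obtain ⟨u, X₁, X₂, l1, f, l2, hX, hU⟩ := l.split_after (v := d) hd
    (fun h => hce (hcd.trans (congrArg col h)))
  refine ⟨u, X₁, X₂, l1, l2.symm, hX, hU, ?_, ?_⟩
  · have : u ∈ X₁ ∪ X₂ := Or.inr l2.left_mem
    rwa [← hU] at this
  · have := H.col_adj f
    rw [← hcd] at this
    revert this hce
    cases col c <;> cases col u <;> cases col e <;> simp

/-- A layer without terminals can be absorbed by a cover. -/
lemma absorb (H : Layered G lay col mv n) (hn : 2 ≤ n) {ι : Type} {J : Finset ι}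
    (hJ : J.Nonempty) {a b : ι → V} (hab : ∀ i ∈ J, col (a i) ≠ col (b i)) {U : Set V}
    (h : Cover G U J a b) {p : L} (hU : ∀ v ∈ U, lay v ≠ p) :
    Cover G (U ∪ {v | lay v = p}) J a b := by
  classical
  obtain ⟨i, hi⟩ := hJ
  obtain ⟨X, U', l, h', hd, rfl⟩ := h.peel hi
  obtain ⟨z, X₁, X₂, l1, e, l2, hX, rfl⟩ :=
    l.split_after l.left_mem (fun h => hab i hi (congrArg col h))
  have ha : lay (a i) ≠ p := hU _ (Or.inr l.left_mem)
  have hz : lay z ≠ p := hU _ (Or.inr (Or.inr l2.left_mem))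
  have hl := H.link_layer hn (u := mv p (a i)) (v := mv p z)
    (by rw [H.lay_mv ha, H.lay_mv hz])
    (by rw [H.col_mv ha, H.col_mv hz]; have := H.col_adj e; simpa using this)
  rw [H.lay_mv ha] at hl
  have hdis : ∀ Y ⊆ U' ∪ (X₁ ∪ X₂), Disjoint Y {v | lay v = p} := fun Y hY =>
    Set.disjoint_left.2 fun v hv => hU v (hY hv)
  have l3 := (l1.append (H.adj_mv ha) hl (hdis _ (by grind))).append (H.adj_mv hz).symm l2
    (by rw [Set.disjoint_union_left]; exact ⟨hX, (hdis _ (by grind)).symm⟩)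
  have := h'.insert l3 (by simp) (by
    simp only [Set.disjoint_union_right] at hd ⊢
    exact ⟨⟨hd.1, hdis _ (by grind)⟩, hd.2⟩)
  rw [Finset.insert_erase hi] at this
  convert this using 1
  ext v; simp only [Set.mem_union]; tauto

end Layered

namespace Layered

variable {V L : Type} {G : SimpleGraph V} {lay : V → L} {col : V → Bool} {mv : L → V → V} {n : ℕ}

lemma cover_layers_of_lay_eq (H : Layered G lay col mv n) (hn : 2 ≤ n) [DecidableEq L]
    (P : Finset L) {ι : Type} (J : Finset ι) (hJ : J.Nonempty) (a b : ι → V)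
    (hab : Admissible col J a b) (ha : ∀ i ∈ J, lay (a i) ∈ P)
    (hlay : ∀ i ∈ J, lay (a i) = lay (b i))
    (ht : ∀ p ∈ P, (J.filter fun i => lay (a i) = p ∨ lay (b i) = p).card ≤ n - 1) :
    Cover G {v | lay v ∈ P} J a b := by
  classical
  set P₀ := J.image (fun i => lay (a i)) with hP₀
  have key : ∀ Q : Finset L, Disjoint P₀ Q → Cover G {v | lay v ∈ P₀ ∪ Q} J a b := by
    intro Q
    induction Q using Finset.induction_on with
    | empty =>
      intro _
      have hex : ∀ p ∈ P₀, Cover G {v | lay v = p} (J.filter fun i => lay (a i) = p) a b := by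
        intro p hp
        obtain ⟨i, hi, hip⟩ := Finset.mem_image.1 hp
        refine H.cover_layer p _ ⟨i, by simp [hi, hip]⟩ ?_ a b
          (hab.mono (Finset.filter_subset _ _)) ?_ ?_
        · refine (Finset.card_le_card ?_).trans (ht p (hip ▸ ha i hi))
          intro j hj
          simp only [Finset.mem_filter] at hj ⊢
          exact ⟨hj.1, Or.inl hj.2⟩
        · intro j hj
          exact (Finset.mem_filter.1 hj).2
        · intro j hj
          rw [Finset.mem_filter] at hj
          rw [← hlay j hj.1, hj.2]
      choose! X x1 x2 x3 using hex
      have hmem : ∀ i ∈ J, lay (a i) ∈ P₀ := fun i hi => Finset.mem_image_of_mem _ hi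
      have hX : ∀ i ∈ J, ∀ v ∈ X (lay (a i)) i, lay v = lay (a i) := fun i hi v hv =>
        (x3 _ (hmem i hi) v).2 ⟨i, by simp [hi], hv⟩
      refine ⟨fun i => X (lay (a i)) i, ?_, ?_, ?_⟩
      · exact fun i hi => x1 _ (hmem i hi) i (by simp [hi])
      · intro i hi j hj hij
        by_cases h : lay (a i) = lay (a j)
        · have := x2 _ (hmem i hi) i (by simp [hi]) j (by simp [hj, h]) hij
          simpa only [h] using this
        · exact Set.disjoint_left.2 fun v hv hv' => h ((hX i hi v hv).symm.trans (hX j hj v hv'))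
      · intro v
        constructor
        · intro hv
          have hv : lay v ∈ P₀ := by simpa using hv
          obtain ⟨i, hi, hvi⟩ := (x3 _ hv v).1 rfl
          rw [Finset.mem_filter] at hi
          exact ⟨i, hi.1, by simpa only [hi.2] using hvi⟩
        · rintro ⟨i, hi, hv⟩
          have := hX i hi v hv
          simpa [this] using hmem i hi
    | insert p Q hpQ ih =>
      intro hd
      rw [Finset.disjoint_insert_right] at hd
      have := H.absorb hn hJ hab.1 (ih hd.2) (p := p) (by
        rintro v hv rfl
        simp only [Set.mem_ofPred_eq, Finset.mem_union] at hv
        exact hv.elim hd.1 hpQ)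
      convert this using 1
      ext v
      simp only [Set.mem_ofPred_eq, Set.mem_union, Finset.mem_union, Finset.mem_insert]
      tauto
  have hsub : P₀ ⊆ P := by
    intro p hp
    obtain ⟨i, hi, hip⟩ := Finset.mem_image.1 hp
    exact hip ▸ ha i hi
  have := key (P \ P₀) Finset.disjoint_sdiff
  rwa [Finset.union_sdiff_of_subset hsub] at this

/-- If every layer is touched by at most `n - 1` pairs, then the pairs can be joined by a cover. -/
lemma cover_layers (H : Layered G lay col mv n) (hn : 2 ≤ n) [DecidableEq L]
    (P : Finset L) {ι : Type} (J : Finset ι) (hJ : J.Nonempty) (a b : ι → V)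
    (hab : Admissible col J a b) (ha : ∀ i ∈ J, lay (a i) ∈ P) (hb : ∀ i ∈ J, lay (b i) ∈ P)
    (ht : ∀ p ∈ P, (J.filter fun i => lay (a i) = p ∨ lay (b i) = p).card ≤ n - 1) :
    Cover G {v | lay v ∈ P} J a b := by
  classical
  induction hN : (J.filter fun i => lay (a i) ≠ lay (b i)).card using Nat.strong_induction_on
    generalizing ι with
  | _ N ih =>
  by_cases hlay : ∀ i ∈ J, lay (a i) = lay (b i)
  · exact H.cover_layers_of_lay_eq hn P J hJ a b hab ha hlay ht
  push Not at hlay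
  obtain ⟨i, hi, hpq⟩ := hlay
  let T : L → Finset ι := fun p => J.filter fun i => lay (a i) = p ∨ lay (b i) = p
  let r : Bool → ι → V := fun c j => if col (a j) = c then a j else b j
  let F := ((T (lay (a i))).erase i).image (r (!col (a i))) ∪
    ((T (lay (b i))).erase i).image (fun j => mv (lay (a i)) (r (col (a i)) j))
  have hF : F.card ≤ 2 * n - 2 := by
    have h0 := Finset.card_union_le (((T (lay (a i))).erase i).image (r (!col (a i))))
      (((T (lay (b i))).erase i).image (fun j => mv (lay (a i)) (r (col (a i)) j)))
    have h1 := Finset.card_image_le (s := (T (lay (a i))).erase i) (f := r (!col (a i)))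
    have h2 := Finset.card_image_le (s := (T (lay (b i))).erase i)
      (f := fun j => mv (lay (a i)) (r (col (a i)) j))
    have h3 := Finset.card_erase_le (s := T (lay (a i))) (a := i)
    have h4 := Finset.card_erase_le (s := T (lay (b i))) (a := i)
    have h5 := ht _ (ha i hi)
    have h6 := ht _ (hb i hi)
    change F.card ≤ _ at h0
    change (T (lay (a i))).card ≤ _ at h5
    change (T (lay (b i))).card ≤ _ at h6
    omega
  obtain ⟨u, hup, huc, huF⟩ := H.exists_notMem (lay (a i)) (!col (a i)) F hF
  have huq : lay u ≠ lay (b i) := hup ▸ hpq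
  have hu'q := H.lay_mv huq
  have hu'c : col (mv (lay (b i)) u) = col (a i) := by rw [H.col_mv huq, huc, Bool.not_not]
  have hmv : mv (lay (a i)) (mv (lay (b i)) u) = u := by
    have := H.mv_mv huq
    rwa [hup] at this
  have hir : ∀ c, ∀ j ∈ J, ∀ v, (v = a j ∨ v = b j) → col v = c → v = r c j := by
    intro c j hj v hv hc
    have := hab.1 j hj
    rcases hv with rfl | rfl
    · simp [r, hc]
    · simp [r, ← hc, this]
  have hu : ∀ j ∈ J, ¬ (u = a j ∨ u = b j) := by
    intro j hj h
    by_cases hji : j = i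
    · subst hji
      rcases h with h | h
      · rw [h] at huc; simp at huc
      · exact hpq (hup.symm.trans (congrArg lay h))
    · refine huF (Finset.mem_union_left _ (Finset.mem_image.2 ⟨j, ?_, (hir _ j hj u h huc).symm⟩))
      simp only [T, Finset.mem_erase, Finset.mem_filter]
      exact ⟨hji, hj, h.imp (fun h => (congrArg lay h).symm.trans hup)
        (fun h => (congrArg lay h).symm.trans hup)⟩
  have hu' : ∀ j ∈ J, ¬ (mv (lay (b i)) u = a j ∨ mv (lay (b i)) u = b j) := by
    intro j hj h
    by_cases hji : j = i
    · subst hji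
      rcases h with h | h
      · exact hpq ((congrArg lay h).symm.trans hu'q)
      · exact hab.1 j hi (hu'c.symm.trans (congrArg col h))
    · refine huF (Finset.mem_union_right _ (Finset.mem_image.2 ⟨j, ?_, ?_⟩))
      · simp only [T, Finset.mem_erase, Finset.mem_filter]
        exact ⟨hji, hj, h.imp (fun h => (congrArg lay h).symm.trans hu'q)
          (fun h => (congrArg lay h).symm.trans hu'q)⟩
      · rw [← hir _ j hj _ h hu'c, hmv]
  simp only [not_or] at hu hu'
  refine Cover.option (i := i) (x := u) (y := mv (lay (b i)) u) ?_ (H.adj_mv huq) hi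
  refine ih _ ?_ (Finset.insertNone J) ⟨none, by simp⟩ _ _
    (hab.option hi (by simp [huc]) (by simp [huc, hu'c]) hu hu') ?_ ?_ ?_ rfl
  · rw [← hN]
    refine lt_of_le_of_lt (b := ((J.filter fun i => lay (a i) ≠ lay (b i)).erase i).card) ?_
      (Finset.card_erase_lt_of_mem (by simp [hi, hpq]))
    refine Finset.card_le_card_of_injOn (fun o => o.getD i) ?_ ?_
    · rintro (_ | j) hj
      · simp [hu'q] at hj
      · by_cases hji : j = i
        · subst hji; simp [hup] at hj
        · simpa [hji] using hj
    · rintro (_ | j) hj (_ | k) hk hjk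
      · rfl
      · simp [hu'q] at hj
      · simp [hu'q] at hk
      · simpa using hjk
  · rintro (_ | j) hj
    · simpa [hu'q] using hb i hi
    · exact ha j (Finset.some_mem_insertNone.1 hj)
  · rintro (_ | j) hj
    · exact hb i hi
    · by_cases hji : j = i
      · subst hji; simpa [hup] using ha j hi
      · simpa [hji] using hb j (Finset.some_mem_insertNone.1 hj)
  · intro p hp
    refine le_trans ?_ (ht p hp)
    refine Finset.card_le_card_of_injOn (fun o => o.getD i) ?_ ?_
    · rintro (_ | j) hj
      · simp [hu'q] at hj
        simp [hi, hj]
      · by_cases hji : j = i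
        · subst hji
          simp [hup] at hj
          simp [hj]
        · simpa [hji] using hj
    · rintro (_ | j) hj (_ | k) hk hjk
      · rfl
      · have hjk : i = k := hjk
        subst hjk
        simp [hu'q] at hj
        simp [hup] at hk
        exact absurd (hk.2.trans hj.symm) hpq
      · have hjk : j = i := hjk
        subst hjk
        simp [hu'q] at hk
        simp [hup] at hj
        exact absurd (hj.2.trans hk.symm) hpq
      · simpa using hjk

end Layered

namespace Layered

variable {V L : Type} {G : SimpleGraph V} {lay : V → L} {col : V → Bool} {mv : L → V → V} {n : ℕ}

/-- An inner vertex `s` of a path inside a layer can be made the start of a new path with the help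
of a layer without terminals. -/
lemma escape (H : Layered G lay col mv n) (hn : 2 ≤ n) {a b s : V} {X : Set V} {p k : L}
    (h : Link G a b X) (hs : s ∈ X) (hsa : s ≠ a) (hsb : s ≠ b) (hX : ∀ v ∈ X, lay v = p)
    (hk : p ≠ k) : ∃ w Z₁ Z₂, Link G a b Z₁ ∧ Link G s w Z₂ ∧ Disjoint Z₁ Z₂ ∧
      Z₁ ∪ Z₂ = X ∪ {v | lay v = k} ∧ lay w = k ∧ col w ≠ col s := by
  obtain ⟨x, y, X₁, X₂, X₃, l1, e1, l2, e2, l3, d12, d13, d23, rfl⟩ := h.split_mid hs hsa hsb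
  have hs' : lay s ≠ k := hX s hs ▸ hk
  have hx : lay x ≠ k := hX x (Or.inl (Or.inl l1.right_mem)) ▸ hk
  have hy : lay y ≠ k := hX y (Or.inr l3.left_mem) ▸ hk
  have cx := H.col_adj e1
  have cy := H.col_adj e2
  obtain ⟨w, Y₁, Y₂, m1, m2, dY, hY, hw, cw⟩ := H.exists_two_links hn (H.lay_mv hx) (H.lay_mv hy)
    (H.lay_mv hs') (by
      rw [H.col_mv hx, H.col_mv hy]
      revert cx cy; cases col x <;> cases col y <;> cases col s <;> simp)
    (by rw [H.col_mv hx, H.col_mv hs']; simpa using cx)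
  have hd : Disjoint (X₁ ∪ X₂ ∪ X₃) (Y₁ ∪ Y₂) := by
    rw [← hY, Set.disjoint_left]
    rintro v hv rfl
    exact hk (hX v hv).symm
  simp only [Set.disjoint_union_left, Set.disjoint_union_right] at hd
  obtain ⟨⟨⟨d1, d2⟩, d3⟩, ⟨d4, d5⟩, d6⟩ := hd
  refine ⟨w, (X₁ ∪ Y₁) ∪ X₃, X₂ ∪ Y₂,
    (l1.append (H.adj_mv hx) m1 d1).append (H.adj_mv hy).symm l3 ?_,
    l2.append (H.adj_mv hs') m2 d5, ?_, ?_, hw, ?_⟩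
  · simp [Set.disjoint_union_left, d13, d3.symm]
  · simp [Set.disjoint_union_left, Set.disjoint_union_right, d12, d2.symm, d23.symm, d4, dY, d6]
  · rw [hY]; ext v; simp only [Set.mem_union]; tauto
  · rw [cw, H.col_mv hs']; simp

lemma link_layers (H : Layered G lay col mv n) (hn : 2 ≤ n) [DecidableEq L] (P : Finset L)
    {u v : V} (hu : lay u ∈ P) (hv : lay v ∈ P) (hc : col u ≠ col v) :
    Link G u v {w | lay w ∈ P} := by
  obtain ⟨X, h1, -, h3⟩ := H.cover_layers hn P (Finset.univ : Finset Unit) (by simp)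
    (fun _ => u) (fun _ => v) ⟨by simpa using hc, by simp⟩ (by simpa using hu) (by simpa using hv)
    (fun p _ => (Finset.card_filter_le _ _).trans (by simp; omega))
  have : {w | lay w ∈ P} = X () := by
    ext w; rw [h3]; exact ⟨fun ⟨_, _, h⟩ => h, fun h => ⟨(), Finset.mem_univ _, h⟩⟩
  rw [this]
  exact h1 () (by simp)

lemma exists_two_links_layers (H : Layered G lay col mv n) (hn : 3 ≤ n) [DecidableEq L]
    (P : Finset L) {u v u' v' : V} {k k' : L} (hk : k ∈ P) (hk' : k' ∈ P) (hkk : k ≠ k')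
    (hu : lay u = k) (hv : lay v = k) (hu' : lay u' = k') (hv' : lay v' = k')
    (hc : col u ≠ col v) (hc' : col u' ≠ col v') :
    ∃ Y Y', Link G u v Y ∧ Link G u' v' Y' ∧ Disjoint Y Y' ∧ {w | lay w ∈ P} = Y ∪ Y' := by
  have ne : ∀ {x y}, lay x = k → lay y = k' → x ≠ y := fun hx hy h =>
    hkk (hx.symm.trans ((congrArg lay h).trans hy))
  obtain ⟨X, h1, h2, h3⟩ := H.cover_layers (by omega) P (Finset.univ : Finset Bool) (by simp)
    (fun o => bif o then u else u') (fun o => bif o then v else v')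
    ⟨by simp [hc, hc'], by
      simp [ne hu hu', ne hv hv', ne hu hv', (ne hu hu').symm, (ne hv hv').symm, (ne hv hu').symm]⟩
    (by simp [hu, hu', hk, hk']) (by simp [hv, hv', hk, hk'])
    (fun p _ => (Finset.card_filter_le _ _).trans (by simp; omega))
  refine ⟨X true, X false, h1 true (by simp), h1 false (by simp), h2 _ (by simp) _ (by simp)
    (by simp), ?_⟩
  ext w; rw [h3]; simp [or_comm]

section

variable {ι : Type} [Fintype ι] [DecidableEq ι] {p : L} {a b : ι → V}

/-- Choose vertices where the paths starting in layer `p` may leave this layer. -/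
lemma exists_exits (H : Layered G lay col mv n) (hι : Fintype.card ι = n)
    (hab : Admissible col Finset.univ a b) :
    ∃ u : ι → V, (∀ i, lay (u i) = p) ∧ Admissible col Finset.univ a u ∧
      (∀ i, lay (b i) = p → u i = b i) ∧
      ∀ i, lay (b i) ≠ p → ∀ j, mv (lay (b i)) (u i) ≠ b j := by
  classical
  have key : ∀ S : Finset ι, (∀ i ∈ S, lay (b i) ≠ p) → ∃ u : ι → V, ∀ i ∈ S,
      lay (u i) = p ∧ col (u i) ≠ col (a i) ∧
      (∀ j, u i ≠ a j ∧ u i ≠ b j ∧ mv (lay (b i)) (u i) ≠ b j) ∧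
      ∀ j ∈ S, i ≠ j → u i ≠ u j := by
    intro S
    induction S using Finset.induction_on with
    | empty => exact fun _ => ⟨a, by simp⟩
    | insert i S hiS ih =>
      intro hS
      obtain ⟨u, hu⟩ := ih fun j hj => hS j (Finset.mem_insert_of_mem hj)
      have hbi := hS i (Finset.mem_insert_self _ _)
      let r : Bool → ι → V := fun c j => if col (a j) = c then a j else b j
      let g : ι → V := fun j => if j ∈ S ∧ col (u j) = !col (a i) then u j else r (!col (a i)) j
      let F := (Finset.univ.erase i).image g ∪
        (Finset.univ.erase i).image (fun j => mv p (r (col (a i)) j))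
      have hF : F.card ≤ 2 * n - 2 := by
        have h1 := Finset.card_union_le ((Finset.univ.erase i).image g)
          ((Finset.univ.erase i).image (fun j => mv p (r (col (a i)) j)))
        have h2 := Finset.card_image_le (s := Finset.univ.erase i) (f := g)
        have h3 := Finset.card_image_le (s := Finset.univ.erase i)
          (f := fun j => mv p (r (col (a i)) j))
        have h4 : (Finset.univ.erase i).card = n - 1 := by
          rw [Finset.card_erase_of_mem (Finset.mem_univ _), Finset.card_univ, hι]
        change F.card ≤ _ at h1
        omega
      obtain ⟨x, hxp, hxc, hxF⟩ := H.exists_notMem p (!col (a i)) F hF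
      have hxg : ∀ j, j ≠ i → x ≠ g j := fun j hj h => hxF (Finset.mem_union_left _
        (Finset.mem_image.2 ⟨j, Finset.mem_erase.2 ⟨hj, Finset.mem_univ _⟩, h.symm⟩))
      have hxr : ∀ j, j ≠ i → x ≠ mv p (r (col (a i)) j) := fun j hj h => hxF
        (Finset.mem_union_right _
          (Finset.mem_image.2 ⟨j, Finset.mem_erase.2 ⟨hj, Finset.mem_univ _⟩, h.symm⟩))
      have hxb : lay x ≠ lay (b i) := by rw [hxp]; exact hbi.symm
      have hxm : mv p (mv (lay (b i)) x) = x := by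
        have := H.mv_mv hxb
        rwa [hxp] at this
      have hxmc : col (mv (lay (b i)) x) = col (a i) := by rw [H.col_mv hxb, hxc, Bool.not_not]
      have hx : ∀ j, x ≠ a j ∧ x ≠ b j ∧ mv (lay (b i)) x ≠ b j := by
        intro j
        have hcj := hab.1 j (Finset.mem_univ _)
        by_cases hji : j = i
        · subst hji
          refine ⟨fun h => ?_, fun h => ?_, fun h => ?_⟩
          · rw [h] at hxc; simp at hxc
          · exact hxb (congrArg lay h)
          · exact hcj (hxmc.symm.trans (congrArg col h))
        · have hg := hxg j hji
          have hr := hxr j hji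
          refine ⟨fun h => ?_, fun h => ?_, fun h => ?_⟩
          · have hc : col (a j) = !col (a i) := by rw [← h, hxc]
            by_cases hjS : j ∈ S
            · have := (hu j hjS).2.1
              rw [hc] at this
              exact hg (by simp [g, this, r, hc, h])
            · exact hg (by simp [g, hjS, r, hc, h])
          · have hc : col (a j) ≠ !col (a i) := by rw [← hxc, h]; exact hcj
            have hjS : j ∉ S := fun hjS => hS j (Finset.mem_insert_of_mem hjS) (by rw [← h, hxp])
            exact hg (by simp only [g, hjS, false_and, if_false, r, hc, h])
          · have hc : col (a j) ≠ col (a i) := by rw [← hxmc, h]; exact hcj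
            exact hr (by simp only [r, hc, if_false]; rw [← h, hxm])
      have hxu : ∀ j ∈ S, x ≠ u j := by
        intro j hj h
        refine hxg j (fun e => hiS (e ▸ hj)) ?_
        have : col (u j) = !col (a i) := by rw [← h, hxc]
        simp [g, hj, this, h]
      have hne : ∀ j ∈ S, j ≠ i := fun j hj e => hiS (e ▸ hj)
      refine ⟨Function.update u i x, ?_⟩
      intro j hj
      rcases Finset.mem_insert.1 hj with rfl | hj'
      · simp only [Function.update_self]
        refine ⟨hxp, by simp [hxc], hx, ?_⟩
        intro k hk hjk
        have hk' := Finset.mem_of_mem_insert_of_ne hk hjk.symm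
        simpa [hne k hk'] using hxu k hk'
      · obtain ⟨u1, u2, u3, u4⟩ := hu j hj'
        simp only [Function.update_of_ne (hne j hj')]
        refine ⟨u1, u2, u3, ?_⟩
        intro k hk hjk
        rcases Finset.mem_insert.1 hk with rfl | hk'
        · simpa using (hxu j hj').symm
        · simpa [hne k hk'] using u4 k hk' hjk
  obtain ⟨u, hu⟩ := key (Finset.univ.filter fun i => lay (b i) ≠ p) (by simp)
  simp only [Finset.mem_filter, Finset.mem_univ, true_and] at hu
  refine ⟨fun i => if lay (b i) = p then b i else u i, ?_, ⟨?_, ?_⟩, ?_, ?_⟩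
  · intro i
    by_cases h : lay (b i) = p
    · simp [h]
    · simp [h, (hu i h).1]
  · intro i hi
    by_cases h : lay (b i) = p
    · simpa [h] using hab.1 i hi
    · simpa [h] using (hu i h).2.1.symm
  · intro i hi j hj hij
    obtain ⟨h1, h2, h3⟩ := hab.2 i hi j hj hij
    refine ⟨h1, ?_, ?_⟩
    · by_cases h : lay (b i) = p <;> by_cases h' : lay (b j) = p
      · simpa [h, h'] using h2
      · simpa [h, h'] using ((hu j h').2.2.1 i).2.1.symm
      · simpa [h, h'] using ((hu i h).2.2.1 j).2.1
      · simpa [h, h'] using (hu i h).2.2.2 j h' hij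
    · by_cases h' : lay (b j) = p
      · simpa [h'] using h3
      · simpa [h'] using ((hu j h').2.2.1 i).1.symm
  · intro i h
    simp [h]
  · intro i h j
    simpa [h] using ((hu i h).2.2.1 j).2.2

end

end Layered

namespace Layered

variable {V L : Type} {G : SimpleGraph V} {lay : V → L} {col : V → Bool} {mv : L → V → V} {n : ℕ}
  [Fintype L] [DecidableEq L] {ι : Type} [Fintype ι] [DecidableEq ι] {p : L} {a b : ι → V}

/-- Vertices `s` and `t` on one path of a layer, all other terminals being in the same layer. -/
lemma cover_univ_of_mem_same (H : Layered G lay col mv n) (hn : 2 ≤ n) {k : L} (hk : k ≠ p)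
    (hab : Admissible col univ a b) {i j : ι} (hij : i ≠ j) {X U : Set V}
    (h : Cover G U ((univ.erase j).erase i) a b) (hX : Link G (a i) (b i) X)
    (hd : Disjoint U X) (hU : {v | lay v = p} = U ∪ X) (hs : a j ∈ X) (ht : b j ∈ X) :
    Cover G Set.univ univ a b := by
  have hi := mem_univ i
  have hj := mem_univ j
  have hji := hab.2 j hj i hi hij.symm
  obtain ⟨x, z, X₁, X₂, X₃, l1, l2, l3, hadj, d12, d13, d23, rfl⟩ := hX.split_two hs ht
    hji.1 (hab.ne hj hi) (hab.ne hi hj).symm hji.2.1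
  have hU' : ∀ v, lay v = p ↔ v ∈ U ∨ (v ∈ X₁ ∨ v ∈ X₂) ∨ v ∈ X₃ := fun v => by
    have := Set.ext_iff.1 hU v
    simpa using this
  have hx : lay x ≠ k := by rw [(hU' x).2 (by simp [l1.right_mem])]; exact hk.symm
  have hz : lay z ≠ k := by rw [(hU' z).2 (by simp [l3.left_mem])]; exact hk.symm
  have hc : col (mv k x) ≠ col (mv k z) := by
    rw [H.col_mv hx, H.col_mv hz]
    have := hab.1 j hj
    rcases hadj with ⟨e1, e2⟩ | ⟨e1, e2⟩ <;>
    · have h1 := H.col_adj e1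
      have h2 := H.col_adj e2
      grind
  have R := H.link_layers hn (univ.erase p) (u := mv k x) (v := mv k z)
    (by simp [H.lay_mv hx, hk]) (by simp [H.lay_mv hz, hk]) hc
  have m := (l1.append (H.adj_mv hx) R (by
    simp only [Set.disjoint_left, mem_erase, mem_univ]; grind)).append (H.adj_mv hz).symm l3 (by
    simp only [Set.disjoint_left, mem_erase, mem_univ] at d13 ⊢; grind)
  have c := (h.insert m (by simp) (by
    simp only [Set.disjoint_left, mem_erase, mem_univ] at hd ⊢; grind)).insert (i := j) l2
      (by simp [hij.symm]) (by
    simp only [Set.disjoint_left, mem_erase, mem_univ] at hd d12 d23 ⊢; grind)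
  convert c using 1
  · ext v
    simp
    grind
  · ext v; simp; grind

end Layered

namespace Layered

variable {V L : Type} {G : SimpleGraph V} {lay : V → L} {col : V → Bool} {mv : L → V → V} {n : ℕ}
  [Fintype L] [DecidableEq L] {ι : Type} [Fintype ι] [DecidableEq ι] {p : L} {a b : ι → V}

/-- Vertices `s` and `t` on two paths of a layer, all other terminals being in the same layer. -/
lemma cover_univ_of_mem_ne (H : Layered G lay col mv n) (hn : 2 ≤ n) {k₁ k₂ k₃ : L}
    (hk₁ : k₁ ≠ p) (hk₂ : k₂ ≠ p) (hk₃ : k₃ ≠ p) (hk₁₂ : k₁ ≠ k₂) (hk₁₃ : k₁ ≠ k₃) (hk₂₃ : k₂ ≠ k₃)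
    (hab : Admissible col univ a b) {i i' j : ι} (hij : i ≠ j) (hij' : i' ≠ j) (hii : i' ≠ i)
    {X X' U : Set V}
    (h : Cover G U (((univ.erase j).erase i).erase i') a b) (hX : Link G (a i) (b i) X)
    (hX' : Link G (a i') (b i') X') (hd' : Disjoint U X')
    (hd : Disjoint (U ∪ X') X) (hU : {v | lay v = p} = U ∪ X' ∪ X) (hs : a j ∈ X)
    (ht : b j ∈ X') :
    Cover G Set.univ univ a b := by
  have hi := mem_univ i
  have hj := mem_univ j
  have hi' := mem_univ i'
  have hji := hab.2 j hj i hi hij.symm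
  have hji' := hab.2 j hj i' hi' hij'.symm
  have hU' : ∀ v, lay v = p ↔ (v ∈ U ∨ v ∈ X') ∨ v ∈ X := fun v => by
    have := Set.ext_iff.1 hU v
    simpa using this
  obtain ⟨w, Z, Y, l1, l2, dZ, eZ, hw, cw⟩ := H.escape hn hX hs hji.1 (hab.ne hj hi)
    (fun v hv => (hU' v).2 (Or.inr hv)) hk₁.symm
  obtain ⟨w', Z', Y', l1', l2', dZ', eZ', hw', cw'⟩ := H.escape hn hX' ht
    (hab.ne hi' hj).symm hji'.2.1
    (fun v hv => (hU' v).2 (Or.inl (Or.inr hv))) hk₂.symm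
  have hZ : ∀ v, (v ∈ Z ∨ v ∈ Y) ↔ v ∈ X ∨ lay v = k₁ := fun v => by
    have := Set.ext_iff.1 eZ v
    simpa using this
  have hZ' : ∀ v, (v ∈ Z' ∨ v ∈ Y') ↔ v ∈ X' ∨ lay v = k₂ := fun v => by
    have := Set.ext_iff.1 eZ' v
    simpa using this
  have hwk : lay w ≠ k₃ := hw ▸ hk₁₃
  have hwk' : lay w' ≠ k₃ := hw' ▸ hk₂₃
  have R := H.link_layers hn (((univ.erase p).erase k₁).erase k₂) (u := mv k₃ w) (v := mv k₃ w')
    (by simp [H.lay_mv hwk, hk₃, hk₁₃.symm, hk₂₃.symm])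
    (by simp [H.lay_mv hwk', hk₃, hk₁₃.symm, hk₂₃.symm]) (by
      rw [H.col_mv hwk, H.col_mv hwk']
      have := hab.1 j hj
      grind)
  have m := (l2.append (H.adj_mv hwk) R (by
    simp only [Set.disjoint_left, mem_erase, mem_univ]; grind)).append (H.adj_mv hwk').symm l2'.symm
    (by simp only [Set.disjoint_left, mem_erase, mem_univ, Set.mem_union] at hd ⊢; grind)
  have c := ((h.insert l1' (by simp) (by
    simp only [Set.disjoint_left] at hd' ⊢; grind)).insert
      (i := i) l1 (by simp [hii.symm]) (by
    simp only [Set.disjoint_left] at hd ⊢; grind)).insert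
      (i := j) m
      (by simp [hij.symm, hij'.symm]) (by
    simp only [Set.disjoint_left, mem_erase, mem_univ, Set.mem_union] at dZ dZ' hd hd' ⊢; grind)
  convert c using 1
  · ext v
    simp
    grind
  · ext v; simp; grind

lemma cover_univ_of_lay_eq (H : Layered G lay col mv n) (hn : 3 ≤ n) (hL : n + 1 ≤ Fintype.card L)
    (hι : Fintype.card ι = n)
    (hab : Admissible col univ a b) (ha : ∀ i, lay (a i) = p) (hb : ∀ i, lay (b i) = p) :
    Cover G Set.univ univ a b := by
  obtain ⟨K, hK, hK3⟩ := Finset.exists_subset_card_eq (s := univ.erase p) (n := 3) (by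
    rw [card_erase_of_mem (mem_univ _), card_univ]; omega)
  obtain ⟨k₁, k₂, k₃, h12, h13, h23, rfl⟩ := card_eq_three.1 hK3
  have hk₁ := ne_of_mem_erase (hK (by simp : k₁ ∈ _))
  have hk₂ := ne_of_mem_erase (hK (by simp : k₂ ∈ _))
  have hk₃ := ne_of_mem_erase (hK (by simp : k₃ ∈ _))
  have : 0 < Fintype.card ι := by omega
  obtain ⟨j⟩ := Fintype.card_pos_iff.1 this
  have hc : (univ.erase j).card = n - 1 := by
    rw [card_erase_of_mem (mem_univ _), card_univ, hι]
  have C := H.cover_layer p (univ.erase j) (card_pos.1 (by omega)) hc.le a b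
    (hab.mono (subset_univ _)) (fun i _ => ha i) (fun i _ => hb i)
  obtain ⟨i, hi, X, U, hs, l, C, hd, hU⟩ := C.peel_mem (v := a j) (ha j)
  have ht : b j ∈ U ∪ X := hU ▸ hb j
  by_cases htX : b j ∈ X
  · exact H.cover_univ_of_mem_same (by omega) hk₁ hab (ne_of_mem_erase hi) C l hd hU hs htX
  · obtain ⟨i', hi', X', U', ht', l', C', hd', rfl⟩ := C.peel_mem (ht.resolve_right htX)
    exact H.cover_univ_of_mem_ne (by omega) hk₁ hk₂ hk₃ h12 h13 h23 hab (ne_of_mem_erase hi)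
      (ne_of_mem_erase (mem_of_mem_erase hi')) (ne_of_mem_erase hi') C' l l' hd' hd hU hs ht'

end Layered

namespace Layered

variable {V L : Type} {G : SimpleGraph V} {lay : V → L} {col : V → Bool} {mv : L → V → V} {n : ℕ}
  [Fintype L] [DecidableEq L] {ι : Type} [Fintype ι] [DecidableEq ι] {p : L} {a b : ι → V}

lemma cover_univ_of_free_layer (H : Layered G lay col mv n) (hn : 3 ≤ n)
    (hL : n + 1 ≤ Fintype.card L) (hι : Fintype.card ι = n)
    (hab : Admissible col univ a b) (ha : ∀ i, lay (a i) = p) {k : L} (hk : k ≠ p)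
    (hbk : ∀ i, lay (b i) ≠ k) (hb : ∀ q, ∃ i, lay (b i) ≠ q) :
    Cover G Set.univ univ a b := by
  obtain ⟨c, i₀, hcp, hck, hi₀, hci⟩ : ∃ c i₀, c ≠ p ∧ c ≠ k ∧ lay (b i₀) ≠ p ∧
      ∀ i, lay (b i) = c → i = i₀ := by
    obtain ⟨c, hc, hc2⟩ := exists_card_fiber_lt_of_card_lt_mul (s := (univ : Finset ι))
      (t := (univ.erase p).erase k) (f := fun i => lay (b i)) (n := 2) (by
        rw [card_erase_of_mem (by simp [hk]), card_erase_of_mem (mem_univ _), card_univ,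
          card_univ, hι]
        omega)
    simp only [mem_erase, mem_univ, and_true] at hc
    have h1 := card_le_one.1 (Nat.lt_succ_iff.1 hc2)
    simp only [mem_filter, mem_univ, true_and] at h1
    by_cases h : ∃ i, lay (b i) = c
    · obtain ⟨i, hi⟩ := h
      exact ⟨c, i, hc.2, hc.1, hi ▸ hc.2, fun j hj => h1 j hj i hi⟩
    · obtain ⟨i, hi⟩ := hb p
      exact ⟨c, i, hc.2, hc.1, hi, fun j hj => absurd ⟨j, hj⟩ h⟩
  obtain ⟨u, hu, hau, hub, hmu⟩ := H.exists_exits hι hab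
  have hc : (univ.erase i₀).card = n - 1 := by
    rw [card_erase_of_mem (mem_univ _), card_univ, hι]
  have C := H.cover_layer p (univ.erase i₀) (card_pos.1 (by omega)) hc.le a u
    (hau.mono (subset_univ _)) (fun i _ => ha i) (fun i _ => hu i)
  obtain ⟨i₁, hi₁, X, U, hs, l, C, hd, hU⟩ := C.peel_mem (v := a i₀) (ha i₀)
  have hii := ne_of_mem_erase hi₁
  have hU' : ∀ v, lay v = p ↔ v ∈ U ∨ v ∈ X := fun v => by
    have := Set.ext_iff.1 hU v
    simpa using this
  obtain ⟨w, Z, Y, l1, l2, dZ, eZ, hw, cw⟩ := H.escape (by omega) l hs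
    (hab.2 _ (mem_univ _) _ (mem_univ _) hii.symm).1 (hau.ne (mem_univ _) (mem_univ _))
    (fun v hv => (hU' v).2 (Or.inr hv)) hk.symm
  have hZ : ∀ v, (v ∈ Z ∨ v ∈ Y) ↔ v ∈ X ∨ lay v = k := fun v => by
    have := Set.ext_iff.1 eZ v
    simpa using this
  have C1 : Cover G {v | lay v = p ∨ lay v = k} univ a (Function.update u i₀ w) := by
    have c := ((C.congr (a' := a) (b' := Function.update u i₀ w) (fun _ _ => rfl)
      (fun j hj => by simp [ne_of_mem_erase (mem_of_mem_erase hj)])).insert (i := i₁)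
      (by simpa [hii] using l1) (by simp) (by
        simp only [Set.disjoint_left] at hd ⊢; grind)).insert (i := i₀) (by simpa using l2)
      (by simp [hii.symm]) (by simp only [Set.disjoint_left] at hd dZ ⊢; grind)
    convert c using 1
    · ext v; simp; grind
    · ext v; simp; grind
  have hwc : lay w ≠ c := hw ▸ hck.symm
  have hul : ∀ i, lay (b i) ≠ p → lay (u i) ≠ lay (b i) := fun i hi => hu i ▸ hi.symm
  let v : ι → V := fun i => if i = i₀ then mv c w else mv (lay (b i)) (u i)
  have hv₀ : v i₀ = mv c w := if_pos rfl
  have hv : ∀ i, i ≠ i₀ → v i = mv (lay (b i)) (u i) := fun i hi => if_neg hi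
  have hlv₀ : lay (v i₀) = c := by rw [hv₀, H.lay_mv hwc]
  have hlv : ∀ i, i ≠ i₀ → lay (b i) ≠ p → lay (v i) = lay (b i) := fun i hi hi' => by
    rw [hv i hi, H.lay_mv (hul i hi')]
  have hcv : ∀ i, lay (b i) ≠ p → col (v i) = col (a i) := by
    intro i hi
    by_cases h : i = i₀
    · subst h; rw [hv₀, H.col_mv hwc, Bool.not_eq.2 cw]
    · rw [hv i h, H.col_mv (hul i hi), Bool.not_eq.2 (hau.1 i (mem_univ i)).symm]
  have C2 : Cover G {v | lay v ∈ (univ.erase p).erase k} (univ.filter fun i => lay (b i) ≠ p)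
      v b := by
    apply H.cover_layers (by omega) _ _ ⟨i₀, by simpa using hi₀⟩
    · refine ⟨?_, ?_⟩
      · intro i hi
        rw [hcv i (by simpa using hi)]
        exact hab.1 i (mem_univ _)
      · intro i hi j hj hij
        simp only [mem_filter, mem_univ, true_and] at hi hj
        refine ⟨?_, (hab.2 i (mem_univ _) j (mem_univ _) hij).2.1, ?_⟩
        · intro e
          by_cases h : i = i₀
          · subst h
            have := hlv j hij.symm hj
            rw [← e, hlv₀] at this
            exact hij (hci j this.symm).symm
          · by_cases h' : j = i₀
            · subst h'
              have := hlv i hij hi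
              rw [e, hlv₀] at this
              exact hij (hci i this.symm)
            · have h1 := hlv i h hi
              rw [e, hlv j h' hj] at h1
              rw [hv i h, hv j h', h1] at e
              exact (hau.2 i (mem_univ _) j (mem_univ _) hij).2.1
                (H.mv_inj (hul i hi) (by rw [hu, hu]) e)
        · by_cases h : i = i₀
          · subst h
            intro e
            rw [e] at hlv₀
            exact hij (hci j hlv₀).symm
          · rw [hv i h]
            exact hmu i hi j
    · intro i hi
      simp only [mem_filter, mem_univ, true_and] at hi
      by_cases h : i = i₀
      · subst h; simp [hlv₀, hck, hcp]
      · simp [hlv i h hi, hi, hbk]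
    · intro i hi
      simp only [mem_filter, mem_univ, true_and] at hi
      simp [hi, hbk]
    · intro q hq
      simp only [mem_erase, mem_univ, and_true] at hq
      by_cases hqc : q = c
      · subst hqc
        refine (card_le_card (t := {i₀}) ?_).trans (by simp; omega)
        intro i hi
        simp only [mem_filter, mem_univ, true_and, mem_singleton] at hi ⊢
        by_contra h
        rw [hlv i h hi.1, or_self] at hi
        exact h (hci i hi.2)
      · obtain ⟨j, hj⟩ := hb q
        rw [← hι, ← card_univ, ← card_erase_of_mem (mem_univ j)]
        apply card_le_card
        intro i hi
        simp only [mem_filter, mem_univ, true_and, mem_erase, and_true] at hi ⊢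
        rintro rfl
        by_cases h : i = i₀
        · subst h
          rw [hlv₀] at hi
          exact hi.2.elim (fun h => hqc h.symm) hj
        · rw [hlv i h hi.1, or_self] at hi
          exact hj hi.2
  have C3 := C1.join C2 (subset_univ _) (by
    simp only [Set.disjoint_left, mem_erase, mem_univ]; simp; grind) (by
      intro i hi
      simp only [mem_filter, mem_univ, true_and] at hi
      by_cases h : i = i₀
      · subst h
        rw [hv₀, Function.update_self]
        exact H.adj_mv hwc
      · rw [hv i h, Function.update_of_ne h]
        exact H.adj_mv (hul i hi)) (by
      intro i _ hi
      simp only [mem_filter, mem_univ, true_and, not_not] at hi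
      rw [Function.update_of_ne (by rintro rfl; exact hi₀ hi), hub i hi])
  convert C3 using 1
  ext v; simp; grind

end Layered

namespace Layered

variable {V L : Type} {G : SimpleGraph V} {lay : V → L} {col : V → Bool} {mv : L → V → V} {n : ℕ}

lemma cover_layers_of_injective (H : Layered G lay col mv n) (hn : 2 ≤ n) [DecidableEq L]
    (P : Finset L) {ι : Type} {J : Finset ι} (hJ : J.Nonempty) {a b : ι → V}
    (hc : ∀ i ∈ J, col (a i) ≠ col (b i)) (hb : ∀ i ∈ J, lay (b i) ∈ P)
    (hlay : ∀ i ∈ J, lay (a i) = lay (b i))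
    (hinj : ∀ i ∈ J, ∀ j ∈ J, lay (b i) = lay (b j) → i = j) :
    Cover G {v | lay v ∈ P} J a b := by
  refine H.cover_layers_of_lay_eq hn P J hJ a b ⟨hc, ?_⟩ (fun i hi => hlay i hi ▸ hb i hi) hlay ?_
  · intro i hi j hj hij
    refine ⟨fun e => hij (hinj i hi j hj ?_), fun e => hij (hinj i hi j hj ?_),
      fun e => hij (hinj i hi j hj ?_)⟩
    · rw [← hlay i hi, e, hlay j hj]
    · rw [e]
    · rw [← hlay i hi, e]
  · intro q _
    refine (card_le_one.2 ?_).trans (by omega : 1 ≤ n - 1)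
    intro i hi j hj
    simp only [mem_filter] at hi hj
    rw [hlay i hi.1, or_self] at hi
    rw [hlay j hj.1, or_self] at hj
    exact hinj i hi.1 j hj.1 (hi.2.trans hj.2.symm)

variable {ι : Type} [Fintype ι] [DecidableEq ι] {p : L} {a b : ι → V}

/-- If the terminals in a layer have the same colour, then the layer is covered by `n` paths
starting there. -/
lemma exists_cover_of_col_eq (H : Layered G lay col mv n) (hn : 2 ≤ n)
    (hι : Fintype.card ι = n) (hab : Admissible col univ a b) (ha : ∀ i, lay (a i) = p)
    (hcol : ∀ i j, col (a i) = col (a j)) :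
    ∃ u : ι → V, Cover G {v | lay v = p} univ a u ∧ (∀ i, lay (u i) = p) ∧
      (∀ i, col (u i) ≠ col (a i)) ∧ Function.Injective u := by
  obtain ⟨u, hu, hau, -, -⟩ := H.exists_exits (p := p) hι hab
  obtain ⟨i₀⟩ := Fintype.card_pos_iff.1 (by omega : 0 < Fintype.card ι)
  have hc : (univ.erase i₀).card = n - 1 := by
    rw [card_erase_of_mem (mem_univ _), card_univ, hι]
  have C := H.cover_layer p (univ.erase i₀) (card_pos.1 (by omega)) hc.le a u
    (hau.mono (subset_univ _)) (fun i _ => ha i) (fun i _ => hu i)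
  obtain ⟨i₁, hi₁, X, U, hs, l, C, hd, hU⟩ := C.peel_mem (v := a i₀) (ha i₀)
  have hii := ne_of_mem_erase hi₁
  obtain ⟨x, X₁, X₂, l1, e, l2, d12, rfl⟩ := l.split_before hs
    (hab.2 _ (mem_univ _) _ (mem_univ _) hii.symm).1
  have C' := ((C.congr (a' := a) (b' := Function.update (Function.update u i₁ x) i₀ (u i₁))
      (fun _ _ => rfl) (fun j hj => by
        simp [ne_of_mem_erase hj, ne_of_mem_erase (mem_of_mem_erase hj)])).insert (i := i₁)
      (by simpa [hii] using l1) (by simp) (by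
        simp only [Set.disjoint_left] at hd ⊢; grind)).insert (i := i₀) (by simpa using l2)
      (by simp [hii.symm]) (by simp only [Set.disjoint_left] at hd d12 ⊢; grind)
  have hx : ∀ j, j ≠ i₀ → j ≠ i₁ → x ≠ u j := by
    rintro j h h' rfl
    obtain ⟨Y, U', l', -, hd', rfl⟩ := C.peel (i := j) (by simp [h, h'])
    exact Set.disjoint_left.1 hd (Or.inr l'.right_mem) (Or.inl l1.right_mem)
  have hxu : x ≠ u i₁ := by
    rintro rfl
    exact Set.disjoint_left.1 d12 l1.right_mem l2.right_mem
  refine ⟨Function.update (Function.update u i₁ x) i₀ (u i₁), ?_, ?_, ?_, ?_⟩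
  · rw [insert_erase (by simp [hii]), insert_erase (mem_univ _)] at C'
    convert C' using 1
    rw [hU, Set.union_assoc]
  · intro i
    by_cases h : i = i₀
    · subst h; simp [hu]
    · by_cases h' : i = i₁
      · subst h'
        have : x ∈ {v | lay v = p} := hU ▸ Or.inr (Or.inl l1.right_mem)
        simpa [h] using this
      · simp [h, h', hu]
  · intro i
    by_cases h : i = i₀
    · subst h; simpa [hcol i i₁] using (hau.1 i₁ (mem_univ _)).symm
    · by_cases h' : i = i₁
      · subst h'
        simpa [h, hcol i i₀] using H.col_adj e
      · simpa [h, h'] using (hau.1 i (mem_univ _)).symm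
  · have hinj : ∀ i j, i ≠ j → u i ≠ u j := fun i j hij =>
      (hau.2 i (mem_univ _) j (mem_univ _) hij).2.1
    intro i j
    simp only [Function.update_apply]
    grind

end Layered

namespace Layered

variable {V L : Type} {G : SimpleGraph V} {lay : V → L} {col : V → Bool} {mv : L → V → V} {n : ℕ}
  [Fintype L] [DecidableEq L] {ι : Type} [Fintype ι] [DecidableEq ι] {p : L} {a b : ι → V}

lemma cover_univ_of_injective_of_col_eq (H : Layered G lay col mv n) (hn : 3 ≤ n)
    (hι : Fintype.card ι = n) (hab : Admissible col univ a b) (ha : ∀ i, lay (a i) = p)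
    (hb : ∀ i, lay (b i) ≠ p) (hinj : ∀ i j, lay (b i) = lay (b j) → i = j)
    (hcol : ∀ i j, col (a i) = col (a j)) : Cover G Set.univ univ a b := by
  obtain ⟨u, C, hu, hcu, -⟩ := H.exists_cover_of_col_eq (by omega) hι hab ha hcol
  have hul : ∀ i, lay (u i) ≠ lay (b i) := fun i => hu i ▸ (hb i).symm
  obtain ⟨i₀⟩ := Fintype.card_pos_iff.1 (by omega : 0 < Fintype.card ι)
  have C2 := H.cover_layers_of_injective (by omega) (univ.erase p) (J := univ)
    ⟨i₀, mem_univ _⟩ (a := fun i => mv (lay (b i)) (u i)) (b := b)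
    (fun i _ => by
      rw [H.col_mv (hul i), Bool.not_eq.2 (hcu i)]
      exact hab.1 i (mem_univ i))
    (fun i _ => by simpa using hb i) (fun i _ => H.lay_mv (hul i)) (fun i _ j _ => hinj i j)
  have C3 := C.join C2 (subset_univ _) (by simp [Set.disjoint_left])
    (fun i _ => H.adj_mv (hul i)) (by simp)
  convert C3 using 1
  ext v; simp; tauto

lemma cover_univ_of_injective_of_col_ne (H : Layered G lay col mv n) (hn : 3 ≤ n)
    (hι : Fintype.card ι = n) (hab : Admissible col univ a b) (ha : ∀ i, lay (a i) = p)
    (hb : ∀ i, lay (b i) ≠ p) (hinj : ∀ i j, lay (b i) = lay (b j) → i = j)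
    {i₁ i₂ : ι} (hcol : col (a i₁) ≠ col (a i₂)) : Cover G Set.univ univ a b := by
  have h12 : i₁ ≠ i₂ := by rintro rfl; exact hcol rfl
  obtain ⟨u, hu, hau, -, -⟩ := H.exists_exits (p := p) hι hab
  have hc : (univ.erase i₂).card = n - 1 := by
    rw [card_erase_of_mem (mem_univ _), card_univ, hι]
  have C := H.cover_layer p (univ.erase i₂) (card_pos.1 (by omega)) hc.le a
    (Function.update u i₁ (a i₂)) (by
      refine ⟨?_, ?_⟩
      · intro i _
        by_cases h : i = i₁
        · subst h; simpa using hcol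
        · simpa [h] using hau.1 i (mem_univ _)
      · intro i hi j hj hij
        have hh := hau.2 i (mem_univ _) j (mem_univ _) hij
        have hi2 := fun k => hau.ne (mem_univ i₂) (mem_univ k)
        have hia := (hau.2 i (mem_univ _) i₂ (mem_univ _) (ne_of_mem_erase hi)).1
        refine ⟨hh.1, ?_, ?_⟩ <;> simp only [Function.update_apply] <;> grind)
    (fun i _ => ha i) (fun i _ => by
      simp only [Function.update_apply]; split_ifs <;> simp [ha, hu])
  obtain ⟨X, U, l, C, hd, hU⟩ := C.peel (i := i₁) (by simp [h12])
  rw [Function.update_self] at l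
  obtain ⟨z, X₁, X₂, l1, e, l2, d12, rfl⟩ := l.split_after l.left_mem
    (fun h => hcol (congrArg col h))
  have hU' : ∀ v, lay v = p ↔ v ∈ U ∨ v ∈ X₁ ∨ v ∈ X₂ := fun v => by
    have := Set.ext_iff.1 hU v
    simpa using this
  have hz := (hU' z).2 (Or.inr (Or.inr l2.left_mem))
  have hzq : lay z ≠ lay (b i₁) := hz ▸ (hb i₁).symm
  have haq : lay (a i₁) ≠ lay (b i₁) := ha i₁ ▸ (hb i₁).symm
  have he := H.col_adj e
  obtain ⟨w, Y₁, Y₂, m1, m2, dY, hY, hw, cw⟩ := H.exists_two_links (by omega) (p := lay (b i₁))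
    (H.lay_mv haq) (d := b i₁) rfl (H.lay_mv hzq)
    (by rw [H.col_mv haq]; exact Bool.not_eq.2 (hab.1 i₁ (mem_univ _)))
    (by rw [H.col_mv haq, H.col_mv hzq]; simpa using he)
  rw [H.col_mv hzq] at cw
  have hY' : ∀ v, lay v = lay (b i₁) ↔ v ∈ Y₁ ∨ v ∈ Y₂ := fun v => by
    have := Set.ext_iff.1 hY v
    simpa using this
  let E := Function.update (Function.update u i₁ (b i₁)) i₂ w
  have hE1 : E i₁ = b i₁ := by simp [E, h12]
  have hE2 : E i₂ = w := by simp [E]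
  have hE : ∀ j, j ≠ i₁ → j ≠ i₂ → E j = u j := fun j h h' => by simp [E, h, h']
  have hdis : ∀ v, v ∈ U ∨ v ∈ X₁ ∨ v ∈ X₂ → ¬ (v ∈ Y₁ ∨ v ∈ Y₂) := fun v hv hv' =>
    hb i₁ (((hY' v).2 hv').symm.trans ((hU' v).2 hv))
  have n1 := l1.append (H.adj_mv haq) m1 (Set.disjoint_left.2 fun v hv hv' =>
    hdis v (Or.inr (Or.inl hv)) (Or.inl hv'))
  have n2 := l2.symm.append (H.adj_mv hzq) m2 (Set.disjoint_left.2 fun v hv hv' =>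
    hdis v (Or.inr (Or.inr hv)) (Or.inr hv'))
  have C1 : Cover G {v | lay v = p ∨ lay v = lay (b i₁)} univ a E := by
    have c := ((C.congr (a' := a) (b' := E) (fun _ _ => rfl) (fun j hj => by
      have h1 := ne_of_mem_erase hj
      have h2 := ne_of_mem_erase (mem_of_mem_erase hj)
      simp [hE j h1 h2, h1])).insert (i := i₁) (by rw [hE1]; exact n1) (by simp) (by
        simp only [Set.disjoint_left, Set.mem_union] at hd ⊢
        grind)).insert (i := i₂) (by rw [hE2]; exact n2) (by simp [h12.symm]) (by
        simp only [Set.disjoint_left, Set.mem_union] at hd d12 dY ⊢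
        grind)
    convert c using 1
    · ext v; simp; grind
    · ext v; simp; grind
  have hlE : ∀ i, i ≠ i₁ → lay (E i) ≠ lay (b i) := by
    intro i hi
    by_cases h : i = i₂
    · subst h
      rw [hE2, hw]
      exact fun h => h12 (hinj _ _ h)
    · rw [hE i hi h, hu]
      exact (hb i).symm
  have C2 := H.cover_layers_of_injective (by omega) ((univ.erase p).erase (lay (b i₁)))
    (J := univ.erase i₁) ⟨i₂, by simp [h12.symm]⟩ (a := fun i => mv (lay (b i)) (E i)) (b := b)
    (fun i hi => by
      have hi' := ne_of_mem_erase hi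
      have hci := hab.1 i (mem_univ i)
      rw [H.col_mv (hlE i hi')]
      by_cases h : i = i₂
      · subst h
        rw [hE2, cw]
        revert he hcol hci
        cases col z <;> cases col (a i₁) <;> cases col (a i) <;> cases col (b i) <;> simp
      · rwa [hE i hi' h, Bool.not_eq.2 (hau.1 i (mem_univ i)).symm])
    (fun i hi => by
      simp only [mem_erase, mem_univ, and_true]
      exact ⟨fun h => ne_of_mem_erase hi (hinj _ _ h), hb i⟩)
    (fun i hi => H.lay_mv (hlE i (ne_of_mem_erase hi))) (fun i _ j _ => hinj i j)
  have C3 := C1.join C2 (subset_univ _) (by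
      simp only [Set.disjoint_left, mem_erase, mem_univ]; simp; tauto)
    (fun i hi => H.adj_mv (hlE i (ne_of_mem_erase hi))) (by simpa using hE1)
  convert C3 using 1
  ext v; simp; tauto

end Layered

namespace Layered

variable {V L : Type} {G : SimpleGraph V} {lay : V → L} {col : V → Bool} {mv : L → V → V} {n : ℕ}
  [Fintype L] [DecidableEq L] {ι : Type} [Fintype ι] [DecidableEq ι] {p q k₁ k₂ : L} {a b : ι → V}

lemma cover_univ_of_two_layers_of_col_eq (H : Layered G lay col mv n) (hn : 3 ≤ n)
    (hι : Fintype.card ι = n) (hab : Admissible col univ a b) (ha : ∀ i, lay (a i) = p)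
    (hb : ∀ i, lay (b i) = q) (hpq : p ≠ q) (hk₁p : k₁ ≠ p) (hk₁q : k₁ ≠ q) (hk₂p : k₂ ≠ p)
    (hk₂q : k₂ ≠ q) (hkk : k₁ ≠ k₂)
    (hcol : ∀ i j, col (a i) = col (a j)) : Cover G Set.univ univ a b := by
  obtain ⟨u, C, hu, hcu, huinj⟩ := H.exists_cover_of_col_eq (by omega) hι hab ha hcol
  have hul : ∀ i, lay (u i) ≠ q := fun i => hu i ▸ hpq
  obtain ⟨i₀⟩ := Fintype.card_pos_iff.1 (by omega : 0 < Fintype.card ι)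
  have hc : (univ.erase i₀).card = n - 1 := by
    rw [card_erase_of_mem (mem_univ _), card_univ, hι]
  have hcv : ∀ i, col (mv q (u i)) = col (a i) := fun i => by
    rw [H.col_mv (hul i), Bool.not_eq.2 (hcu i)]
  have C2 := H.cover_layer q (univ.erase i₀) (card_pos.1 (by omega)) hc.le
    (fun i => mv q (u i)) b (by
      refine ⟨fun i _ => ?_, fun i _ j _ hij => ⟨fun e => ?_, ?_, fun e => ?_⟩⟩
      · rw [hcv i]
        exact hab.1 i (mem_univ i)
      · exact hij (huinj (H.mv_inj (hul i) (by rw [hu, hu]) e))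
      · exact (hab.2 i (mem_univ _) j (mem_univ _) hij).2.1
      · apply hab.1 j (mem_univ j)
        rw [← e, hcv, hcol i j])
    (fun i _ => H.lay_mv (hul i)) (fun i _ => hb i)
  obtain ⟨i₁, hi₁, X, U, hs, l, C2, hd, hU⟩ := C2.peel_mem (v := b i₀) (hb i₀)
  have hii := ne_of_mem_erase hi₁
  obtain ⟨y, X₁, X₂, l1, e, l2, d12, rfl⟩ := l.split_after hs
    (hab.2 _ (mem_univ _) _ (mem_univ _) hii.symm).2.1
  have hU' : ∀ v, lay v = q ↔ v ∈ U ∨ v ∈ X₁ ∨ v ∈ X₂ := fun v => by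
    have := Set.ext_iff.1 hU v
    simpa using this
  have hy := (hU' y).2 (Or.inr (Or.inr l2.left_mem))
  have hv := H.lay_mv (hul i₁)
  have n1 : lay (u i₁) ≠ k₁ := hu i₁ ▸ hk₁p.symm
  have n2 : lay y ≠ k₁ := hy ▸ hk₁q.symm
  have n3 : lay (u i₀) ≠ k₂ := hu i₀ ▸ hk₂p.symm
  have n4 : lay (mv q (u i₁)) ≠ k₂ := by rw [hv]; exact hk₂q.symm
  obtain ⟨Y, Y', m, m', dY, hY⟩ := H.exists_two_links_layers hn ((univ.erase p).erase q)
    (k := k₁) (k' := k₂)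
    (by simp [hk₁p, hk₁q]) (by simp [hk₂p, hk₂q]) hkk (H.lay_mv n1) (H.lay_mv n2) (H.lay_mv n3)
    (H.lay_mv n4) (by
      have h1 := hcu i₁
      have h2 := H.col_adj e
      have h3 := hab.1 i₀ (mem_univ _)
      rw [hcol i₀ i₁] at h3
      rw [H.col_mv n1, H.col_mv n2]
      revert h1 h2 h3
      cases col (u i₁) <;> cases col (a i₁) <;> cases col (b i₀) <;> cases col y <;> simp)
    (by
      rw [H.col_mv n3, H.col_mv n4, hcv, hcol i₁ i₀]
      simpa using hcu i₀)
  have hY' : ∀ v, lay v ≠ q ∧ lay v ≠ p ↔ v ∈ Y ∨ v ∈ Y' := fun v => by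
    have := Set.ext_iff.1 hY v
    simpa using this
  have hdis : ∀ v, v ∈ U ∨ v ∈ X₁ ∨ v ∈ X₂ → ¬ (v ∈ Y ∨ v ∈ Y') := fun v hv hv' =>
    ((hY' v).2 hv').1 ((hU' v).2 hv)
  have m1 := m.append (H.adj_mv n2).symm l2 (Set.disjoint_left.2 fun v hv hv' =>
    hdis v (Or.inr (Or.inr hv')) (Or.inl hv))
  have m2 := m'.append (H.adj_mv n4).symm l1 (Set.disjoint_left.2 fun v hv hv' =>
    hdis v (Or.inr (Or.inl hv')) (Or.inr hv))
  let E := Function.update (Function.update (fun i => mv q (u i)) i₁ (mv k₁ (u i₁))) i₀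
    (mv k₂ (u i₀))
  have hE1 : E i₁ = mv k₁ (u i₁) := by simp [E, hii]
  have hE0 : E i₀ = mv k₂ (u i₀) := by simp [E]
  have hE : ∀ j, j ≠ i₁ → j ≠ i₀ → E j = mv q (u j) := fun j h h' => by simp [E, h, h']
  have C4 : Cover G {v | lay v ≠ p} univ E b := by
    have c := ((C2.congr (a' := E) (b' := b) (fun j hj =>
        (hE j (ne_of_mem_erase hj) (ne_of_mem_erase (mem_of_mem_erase hj))).symm)
      (fun _ _ => rfl)).insert (i := i₁) (by rw [hE1]; exact m1) (by simp) (by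
        simp only [Set.disjoint_left, Set.mem_union] at hd ⊢
        grind)).insert (i := i₀) (by rw [hE0]; exact m2) (by simp [hii.symm]) (by
        simp only [Set.disjoint_left, Set.mem_union] at hd d12 dY ⊢
        grind)
    convert c using 1
    · ext v
      simp only [Set.mem_ofPred_eq, Set.mem_union]
      grind
    · ext v; simp; grind
  have C5 := C.join C4 (subset_univ _) (by simp [Set.disjoint_left]) (fun i _ => by
    by_cases h : i = i₀
    · subst h; rw [hE0]; exact H.adj_mv n3
    · by_cases h' : i = i₁
      · subst h'; rw [hE1]; exact H.adj_mv n1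
      · rw [hE i h' h]; exact H.adj_mv (hul i)) (by simp)
  convert C5 using 1
  ext v; simp; tauto

lemma cover_univ_of_two_layers_of_col_ne (H : Layered G lay col mv n) (hn : 3 ≤ n)
    (hι : Fintype.card ι = n) (hab : Admissible col univ a b) (ha : ∀ i, lay (a i) = p)
    (hb : ∀ i, lay (b i) = q) (hpq : p ≠ q) (hk₁p : k₁ ≠ p) (hk₁q : k₁ ≠ q) (hk₂p : k₂ ≠ p)
    (hk₂q : k₂ ≠ q) (hkk : k₁ ≠ k₂) {i₁ i₂ : ι} (hcol : col (a i₁) ≠ col (a i₂)) :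
    Cover G Set.univ univ a b := by
  have h12 : i₁ ≠ i₂ := by rintro rfl; exact hcol rfl
  obtain ⟨u, hu, hau, -, hmu⟩ := H.exists_exits (p := p) hι hab
  have hul : ∀ i, lay (u i) ≠ q := fun i => hu i ▸ hpq
  have hc : (univ.erase i₂).card = n - 1 := by
    rw [card_erase_of_mem (mem_univ _), card_univ, hι]
  have C := H.cover_layer p (univ.erase i₂) (card_pos.1 (by omega)) hc.le a
    (Function.update u i₁ (a i₂)) (by
      refine ⟨?_, ?_⟩
      · intro i _
        by_cases h : i = i₁
        · subst h; simpa using hcol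
        · simpa [h] using hau.1 i (mem_univ _)
      · intro i hi j hj hij
        have hh := hau.2 i (mem_univ _) j (mem_univ _) hij
        have hi2 := fun k => hau.ne (mem_univ i₂) (mem_univ k)
        have hia := (hau.2 i (mem_univ _) i₂ (mem_univ _) (ne_of_mem_erase hi)).1
        refine ⟨hh.1, ?_, ?_⟩ <;> simp only [Function.update_apply] <;> grind)
    (fun i _ => ha i) (fun i _ => by
      simp only [Function.update_apply]; split_ifs <;> simp [ha, hu])
  have hcb : col (b i₁) ≠ col (b i₂) := by
    have h1 := hab.1 i₁ (mem_univ _)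
    have h2 := hab.1 i₂ (mem_univ _)
    revert hcol h1 h2
    cases col (a i₁) <;> cases col (a i₂) <;> cases col (b i₁) <;> cases col (b i₂) <;> simp
  have C' := H.cover_layer q (univ.erase i₂) (card_pos.1 (by omega)) hc.le
    (Function.update (fun i => mv q (u i)) i₁ (b i₂)) b (by
      refine ⟨?_, ?_⟩
      · intro i _
        by_cases h : i = i₁
        · subst h; simpa using hcb.symm
        · simpa [h, H.col_mv (hul i), Bool.not_eq.2 (hau.1 i (mem_univ _)).symm]
            using hab.1 i (mem_univ _)
      · intro i hi j hj hij
        have hm : ∀ i k, mv q (u i) ≠ b k := fun i k => by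
          have := hmu i (by rw [hb]; exact hpq.symm) k
          rwa [hb] at this
        have hmm : mv q (u i) ≠ mv q (u j) := fun e =>
          (hau.2 i (mem_univ _) j (mem_univ _) hij).2.1
            (H.mv_inj (hul i) (by rw [hu, hu]) e)
        have hjb := (hab.2 i₂ (mem_univ _) j (mem_univ _) (ne_of_mem_erase hj).symm).2.1
        refine ⟨?_, (hab.2 i (mem_univ _) j (mem_univ _) hij).2.1, ?_⟩ <;>
          simp only [Function.update_apply] <;> grind)
    (fun i _ => by
      simp only [Function.update_apply]; split_ifs <;> simp [hb, H.lay_mv (hul i)])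
    (fun i _ => hb i)
  obtain ⟨X, U, l, C, hd, hU⟩ := C.peel (i := i₁) (by simp [h12])
  rw [Function.update_self] at l
  obtain ⟨z, X₁, X₂, l1, e, l2, d12, rfl⟩ := l.split_after l.left_mem
    (fun h => hcol (congrArg col h))
  have hU' : ∀ v, lay v = p ↔ v ∈ U ∨ v ∈ X₁ ∨ v ∈ X₂ := fun v => by
    have := Set.ext_iff.1 hU v
    simpa using this
  have hz := (hU' z).2 (Or.inr (Or.inr l2.left_mem))
  obtain ⟨X', U₁, l', C', hd', hU₁⟩ := C'.peel (i := i₁) (by simp [h12])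
  rw [Function.update_self] at l'
  obtain ⟨y, X₃, X₄, l3, f, l4, d34, rfl⟩ := l'.symm.split_after l'.right_mem
    (fun h => hcb (congrArg col h))
  have hU₁' : ∀ v, lay v = q ↔ v ∈ U₁ ∨ v ∈ X₃ ∨ v ∈ X₄ := fun v => by
    have := Set.ext_iff.1 hU₁ v
    simpa using this
  have hy := (hU₁' y).2 (Or.inr (Or.inr l4.left_mem))
  have n1 : lay (a i₁) ≠ k₁ := ha i₁ ▸ hk₁p.symm
  have n2 : lay (b i₁) ≠ k₁ := hb i₁ ▸ hk₁q.symm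
  have n3 : lay z ≠ k₂ := hz ▸ hk₂p.symm
  have n4 : lay y ≠ k₂ := hy ▸ hk₂q.symm
  have hci := hab.1 i₁ (mem_univ _)
  obtain ⟨Y, Y', m, m', dY, hY⟩ := H.exists_two_links_layers hn ((univ.erase p).erase q)
    (k := k₁) (k' := k₂)
    (by simp [hk₁p, hk₁q]) (by simp [hk₂p, hk₂q]) hkk (H.lay_mv n1) (H.lay_mv n2) (H.lay_mv n3)
    (H.lay_mv n4) (by rw [H.col_mv n1, H.col_mv n2]; simpa using hci) (by
      have h1 := H.col_adj e
      have h2 := H.col_adj f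
      rw [H.col_mv n3, H.col_mv n4]
      revert h1 h2 hci
      cases col (a i₁) <;> cases col (b i₁) <;> cases col y <;> cases col z <;> simp)
  have hY' : ∀ v, lay v ≠ q ∧ lay v ≠ p ↔ v ∈ Y ∨ v ∈ Y' := fun v => by
    have := Set.ext_iff.1 hY v
    simpa using this
  have hd1 : ∀ v, v ∈ U ∨ v ∈ X₁ ∨ v ∈ X₂ → ¬ (v ∈ Y ∨ v ∈ Y') := fun v hv hv' =>
    ((hY' v).2 hv').2 ((hU' v).2 hv)
  have hd2 : ∀ v, v ∈ U₁ ∨ v ∈ X₃ ∨ v ∈ X₄ → ¬ (v ∈ Y ∨ v ∈ Y') := fun v hv hv' =>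
    ((hY' v).2 hv').1 ((hU₁' v).2 hv)
  have hd3 : ∀ v, v ∈ U ∨ v ∈ X₁ ∨ v ∈ X₂ → ¬ (v ∈ U₁ ∨ v ∈ X₃ ∨ v ∈ X₄) := fun v hv hv' =>
    hpq (((hU' v).2 hv).symm.trans ((hU₁' v).2 hv'))
  have P1 := (l1.append (H.adj_mv n1) m (Set.disjoint_left.2 fun v hv hv' =>
    hd1 v (Or.inr (Or.inl hv)) (Or.inl hv'))).append (H.adj_mv n2).symm l3 (by
      simp only [Set.disjoint_left, Set.mem_union]
      grind)
  have P2 := (l2.symm.append (H.adj_mv n3) m' (Set.disjoint_left.2 fun v hv hv' =>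
    hd1 v (Or.inr (Or.inr hv)) (Or.inr hv'))).append (H.adj_mv n4).symm l4 (by
      simp only [Set.disjoint_left, Set.mem_union]
      grind)
  have C0 := C.join C' Subset.rfl (Set.disjoint_left.2 fun v hv hv' =>
    hd3 v (Or.inl hv) (Or.inl hv')) (fun i hi => by
      simpa [ne_of_mem_erase hi] using H.adj_mv (hul i)) (fun i hi hi' => absurd hi hi')
  have c := (C0.insert (i := i₁) P1 (by simp) (by
      simp only [Set.disjoint_left, Set.mem_union] at hd hd' ⊢
      grind)).insert (i := i₂) P2 (by simp [h12.symm]) (by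
      simp only [Set.disjoint_left, Set.mem_union] at hd hd' d12 d34 dY ⊢
      grind)
  convert c using 1
  · ext v
    simp only [Set.mem_univ, Set.mem_union]
    grind
  · ext v; simp; grind

end Layered

namespace Admissible

variable {V ι : Type} {col : V → Bool} {J : Finset ι} {a b a' b' : ι → V}

lemma swap (h : Admissible col J a b)
    (hs : ∀ i ∈ J, a' i = a i ∧ b' i = b i ∨ a' i = b i ∧ b' i = a i) : Admissible col J a' b' := by
  refine ⟨fun i hi => ?_, fun i hi j hj hij => ?_⟩
  · rcases hs i hi with ⟨e, e'⟩ | ⟨e, e'⟩ <;> rw [e, e']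
    · exact h.1 i hi
    · exact (h.1 i hi).symm
  · obtain ⟨h1, h2, h3⟩ := h.2 i hi j hj hij
    have h4 := (h.2 j hj i hi hij.symm).2.2.symm
    rcases hs i hi with ⟨e, e'⟩ | ⟨e, e'⟩ <;> rcases hs j hj with ⟨f, f'⟩ | ⟨f, f'⟩ <;>
      rw [e, e', f, f']
    · exact ⟨h1, h2, h3⟩
    · exact ⟨h3, h4, h1⟩
    · exact ⟨h4, h3, h2⟩
    · exact ⟨h2, h1, h4⟩

end Admissible

namespace Layered

variable {V L : Type} {G : SimpleGraph V} {lay : V → L} {col : V → Bool} {mv : L → V → V} {n : ℕ}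
  [Fintype L] [DecidableEq L] {ι : Type} [Fintype ι] [DecidableEq ι] {p : L} {a b : ι → V}

lemma cover_univ_of_lay_left_eq (H : Layered G lay col mv n) (hn : 3 ≤ n)
    (hL : n + 1 ≤ Fintype.card L) (hι : Fintype.card ι = n) (hab : Admissible col univ a b)
    (ha : ∀ i, lay (a i) = p) : Cover G Set.univ univ a b := by
  by_cases h0 : ∃ q, ∀ i, lay (b i) = q
  · obtain ⟨q, hb⟩ := h0
    obtain rfl | hpq := eq_or_ne p q
    · exact H.cover_univ_of_lay_eq hn hL hι hab ha hb
    · obtain ⟨k₁, hk₁, k₂, hk₂, hkk⟩ := one_lt_card.1 (show 1 < ((univ.erase p).erase q).card by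
        rw [card_erase_of_mem (by simp [hpq.symm]), card_erase_of_mem (mem_univ _), card_univ]
        omega)
      simp only [mem_erase, mem_univ, and_true] at hk₁ hk₂
      by_cases hcol : ∀ i j, col (a i) = col (a j)
      · exact H.cover_univ_of_two_layers_of_col_eq hn hι hab ha hb hpq hk₁.2 hk₁.1 hk₂.2 hk₂.1
          hkk hcol
      · push Not at hcol
        obtain ⟨i₁, i₂, hcol⟩ := hcol
        exact H.cover_univ_of_two_layers_of_col_ne hn hι hab ha hb hpq hk₁.2 hk₁.1 hk₂.2 hk₂.1
          hkk hcol
  · push Not at h0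
    by_cases h1 : ∃ k, k ≠ p ∧ ∀ i, lay (b i) ≠ k
    · obtain ⟨k, hk, hbk⟩ := h1
      exact H.cover_univ_of_free_layer hn hL hι hab ha hk hbk h0
    · push Not at h1
      have hsub : univ.erase p ⊆ univ.image fun i => lay (b i) := fun q hq => by
        obtain ⟨i, hi⟩ := h1 q (ne_of_mem_erase hq)
        exact mem_image.2 ⟨i, mem_univ _, hi⟩
      have hle := card_image_le (s := univ) (f := fun i => lay (b i))
      have hge := card_le_card hsub
      rw [card_erase_of_mem (mem_univ _), card_univ] at hge
      rw [card_univ] at hle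
      have hinj : Set.InjOn (fun i => lay (b i)) (univ : Finset ι) :=
        card_image_iff.1 (by rw [card_univ]; omega)
      have himg := eq_of_subset_of_card_le hsub (by
        rw [card_erase_of_mem (mem_univ _), card_univ]; omega)
      have hb : ∀ i, lay (b i) ≠ p := fun i =>
        ne_of_mem_erase (himg ▸ mem_image_of_mem (fun i => lay (b i)) (mem_univ i))
      have hinj' : ∀ i j, lay (b i) = lay (b j) → i = j := fun i j h =>
        hinj (by simp) (by simp) h
      by_cases hcol : ∀ i j, col (a i) = col (a j)
      · exact H.cover_univ_of_injective_of_col_eq hn hι hab ha hb hinj' hcol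
      · push Not at hcol
        obtain ⟨i₁, i₂, hcol⟩ := hcol
        exact H.cover_univ_of_injective_of_col_ne hn hι hab ha hb hinj' hcol

/-- Any `n` admissible pairs of a layered graph with at least `n + 1` layers are joined by paths
partitioning the vertex set. -/
theorem cover_univ (H : Layered G lay col mv n) (hn : 3 ≤ n) (hL : n + 1 ≤ Fintype.card L)
    (hι : Fintype.card ι = n) (hab : Admissible col univ a b) : Cover G Set.univ univ a b := by
  by_cases h : ∀ p, (univ.filter fun i => lay (a i) = p ∨ lay (b i) = p).card ≤ n - 1
  · have : Nonempty ι := Fintype.card_pos_iff.1 (by omega)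
    have := H.cover_layers (by omega) univ univ univ_nonempty a b hab (by simp) (by simp)
      fun p _ => h p
    simpa using this
  · push Not at h
    obtain ⟨p, hp⟩ := h
    have hpu : (univ.filter fun i => lay (a i) = p ∨ lay (b i) = p) = univ :=
      eq_univ_of_card _ (by
        have := card_le_univ (univ.filter fun i => lay (a i) = p ∨ lay (b i) = p)
        omega)
    have hp' : ∀ i, lay (a i) = p ∨ lay (b i) = p := fun i => by
      have := mem_univ i
      rw [← hpu, mem_filter] at this
      exact this.2
    let a' i := if lay (a i) = p then a i else b i
    let b' i := if lay (a i) = p then b i else a i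
    have hs : ∀ i, a' i = a i ∧ b' i = b i ∨ a' i = b i ∧ b' i = a i := fun i => by
      by_cases h : lay (a i) = p <;> simp [a', b', h]
    have hla : ∀ i, lay (a' i) = p := fun i => by
      by_cases h : lay (a i) = p
      · simp [a', h]
      · simpa [a', h] using (hp' i).resolve_left h
    refine (H.cover_univ_of_lay_left_eq hn hL hι (hab.swap fun i _ => hs i) hla).swap
      fun i _ => ?_
    rcases hs i with ⟨e, e'⟩ | ⟨e, e'⟩ <;> simp [e, e']

end Layered

lemma isPDPC_iff_cover {V : Type} [Fintype V] {G : SimpleGraph V} {k : ℕ} {s t : Fin k → V} :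
    IsPDPC G s t ↔ Cover G Set.univ univ s t := by
  constructor
  · rintro ⟨P, h1, h2, h3⟩
    refine ⟨fun i => {v | v ∈ (P i).support}, fun i _ => Link.of_walk _ (h1 i), ?_, ?_⟩
    · exact fun i _ j _ hij => Set.disjoint_left.2 (h2 i j hij)
    · simpa using h3
  · rintro ⟨X, h1, h2, h3⟩
    choose P hP hX using fun i => (h1 i (mem_univ i)).exists_walk
    refine ⟨P, hP, fun i j hij v hv hv' => ?_, fun v => ?_⟩
    · exact Set.disjoint_left.1 (h2 i (mem_univ i) j (mem_univ j) hij) ((hX i v).1 hv)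
        ((hX j v).1 hv')
    · obtain ⟨i, -, hi⟩ := (h3 v).1 trivial
      exact ⟨i, (hX i v).2 hi⟩

lemma Cover.map {V V' ι : Type} {G : SimpleGraph V} {G' : SimpleGraph V'} {U : Set V}
    {J : Finset ι} {a b : ι → V} (h : Cover G U J a b) (f : V → V') (hf : Function.Injective f)
    (hadj : ∀ u v, G.Adj u v → G'.Adj (f u) (f v)) :
    Cover G' (f '' U) J (fun i => f (a i)) fun i => f (b i) := by
  obtain ⟨X, h1, h2, h3⟩ := h
  refine ⟨fun i => f '' X i, fun i hi => (h1 i hi).map f hf hadj,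
    fun i hi j hj hij => (Set.disjoint_image_iff hf).2 (h2 i hi j hj hij), fun v => ?_⟩
  constructor
  · rintro ⟨w, hw, rfl⟩
    obtain ⟨i, hi, hwi⟩ := (h3 w).1 hw
    exact ⟨i, hi, w, hwi, rfl⟩
  · rintro ⟨i, hi, w, hw, rfl⟩
    exact ⟨w, (h3 w).2 ⟨i, hi, hw⟩, rfl⟩

lemma exists_injective_apply_eq {W : Type} {A : Finset W} {x : W} (hx : x ∈ A) {k : ℕ}
    (hk : k + 1 ≤ A.card) :
    ∃ s : Fin (k + 1) → W, Function.Injective s ∧ (∀ i, s i ∈ A) ∧ s 0 = x := by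
  classical
  obtain ⟨f⟩ : Nonempty (Fin k ↪ (A.erase x : Finset W)) :=
    Function.Embedding.nonempty_of_card_le (by
      rw [Fintype.card_fin, Fintype.card_coe, card_erase_of_mem hx]; omega)
  have hf : ∀ i, (f i : W) ∈ A.erase x := fun i => (f i).2
  refine ⟨Fin.cons x fun i => f i, ?_, ?_, rfl⟩
  · rw [Fin.cons_injective_iff]
    refine ⟨?_, Subtype.val_injective.comp f.injective⟩
    rintro ⟨i, hi⟩
    exact ne_of_mem_erase (hf i) hi
  · intro i
    refine Fin.cases hx (fun i => mem_of_mem_erase (hf i)) i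

lemma SimpleGraph.Walk.iff_of_adj {W : Type} {G : SimpleGraph W} {Q : W → Prop}
    (hQ : ∀ u v, G.Adj u v → (Q u ↔ Q v)) {u v : W} (p : G.Walk u v) : Q u ↔ Q v := by
  induction p with
  | nil => rfl
  | cons e _ ih => exact (hQ _ _ e).trans ih

namespace IsBipartition

variable {V : Type} {G : SimpleGraph V} {A B : Finset V}

lemma mem_right_iff (h : IsBipartition G A B) {v : V} : v ∈ B ↔ v ∉ A :=
  ⟨fun hB hA => h.2.1 v ⟨hA, hB⟩, fun hA => (h.1 v).resolve_left hA⟩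

lemma mem_iff_of_adj (h : IsBipartition G A B) {u v : V} (e : G.Adj u v) : u ∈ A ↔ v ∉ A := by
  have := h.2.2 e
  rw [h.mem_right_iff, h.mem_right_iff] at this
  tauto

/-- If any two vertices on different sides are joined by a path, a second bipartition of the same
graph agrees with the first one up to exchanging the sides. -/
lemma mem_iff_mem_or (h : IsBipartition G A B) {P : V → Prop}
    (hP : ∀ u v, G.Adj u v → (P u ↔ ¬ P v)) (hconn : ∀ u ∈ A, ∀ v ∈ B, Nonempty (G.Walk u v))
    (hA : A.Nonempty) (hB : B.Nonempty) : (∀ v, P v ↔ v ∈ A) ∨ ∀ v, P v ↔ v ∈ B := by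
  obtain ⟨u₀, hu₀⟩ := hA
  obtain ⟨v₀, hv₀⟩ := hB
  have hQ : ∀ u v, G.Adj u v → ((P u ↔ u ∈ A) ↔ (P v ↔ v ∈ A)) := fun u v e => by
    have := hP u v e
    have := h.mem_iff_of_adj e
    tauto
  have hw : ∀ u ∈ A, ∀ v ∈ B, ((P u ↔ u ∈ A) ↔ (P v ↔ v ∈ A)) := fun u hu v hv =>
    (hconn u hu v hv).some.iff_of_adj (Q := fun w => P w ↔ w ∈ A) hQ
  have hall : ∀ v, ((P v ↔ v ∈ A) ↔ (P u₀ ↔ u₀ ∈ A)) := fun v => by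
    rcases h.1 v with hv | hv
    · exact (hw v hv v₀ hv₀).trans (hw u₀ hu₀ v₀ hv₀).symm
    · exact (hw u₀ hu₀ v hv).symm
  by_cases h0 : P u₀ ↔ u₀ ∈ A
  · exact Or.inl fun v => (hall v).2 h0
  · refine Or.inr fun v => ?_
    have := hall v
    rw [h.mem_right_iff]
    tauto

end IsBipartition

/-- Any admissible pairs of the right number are covered, whatever side each vertex is on. -/
lemma cover_univ_of_isPDPC {W : Type} [Fintype W] {G : SimpleGraph W} {A B : Finset W} {k : ℕ}
    (h : IsBipartition G A B)
    (hpdpc : ∀ s t : Fin k → W, Function.Injective s → Function.Injective t →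
      (∀ i, s i ∈ A) → (∀ i, t i ∈ B) → IsPDPC G s t)
    {c : W → Bool} (hc : ∀ u v, c u ≠ c v → (u ∈ A ↔ v ∉ A)) {a b : Fin k → W}
    (hab : Admissible c univ a b) : Cover G Set.univ univ a b := by
  classical
  let a' i := if a i ∈ A then a i else b i
  let b' i := if a i ∈ A then b i else a i
  have hs : ∀ i, a' i = a i ∧ b' i = b i ∨ a' i = b i ∧ b' i = a i := fun i => by
    by_cases h : a i ∈ A <;> simp [a', b', h]
  have hab' := hab.swap fun i _ => hs i
  refine (isPDPC_iff_cover.1 (hpdpc a' b' (fun i j e => ?_) (fun i j e => ?_) (fun i => ?_)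
    fun i => ?_)).swap fun i _ => ?_
  · by_contra hij
    exact (hab'.2 i (mem_univ _) j (mem_univ _) hij).1 e
  · by_contra hij
    exact (hab'.2 i (mem_univ _) j (mem_univ _) hij).2.1 e
  · have := hc _ _ (hab.1 i (mem_univ _))
    by_cases h : a i ∈ A
    · simp [a', h]
    · simp only [a', h, if_false]; tauto
  · have := hc _ _ (hab.1 i (mem_univ _))
    rw [h.mem_right_iff]
    by_cases h : a i ∈ A
    · simp only [b', h, if_true]; tauto
    · simp [b', h]
  · rcases hs i with ⟨e, e'⟩ | ⟨e, e'⟩ <;> simp [e, e']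

lemma IsWeld.exists_layered {W : Type} [Fintype W] [DecidableEq W] {n ℓ : ℕ} (hn : 2 ≤ n)
    {Gs : Fin ℓ → SimpleGraph W} (hcard : 4 * n - 2 ≤ Fintype.card W) {A B : Fin ℓ → Finset W}
    (hbipj : ∀ j, IsBipartition (Gs j) (A j) (B j)) (heqj : ∀ j, (A j).card = (B j).card)
    (hpdpc : ∀ j, ∀ s t : Fin (n - 1) → W, Function.Injective s → Function.Injective t →
      (∀ i, s i ∈ A j) → (∀ i, t i ∈ B j) → IsPDPC (Gs j) s t)
    {G : SimpleGraph (Fin ℓ × W)} (hweld : IsWeld G Gs)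
    {V1 V2 : Finset (Fin ℓ × W)} (hbip : IsBipartition G V1 V2) :
    ∃ mv, Layered G Prod.fst (fun v => decide (v ∈ V1)) mv n := by
  obtain ⟨hlayer, hmatch⟩ := hweld
  choose! f hf using hmatch
  have hAB : ∀ j, (A j).card + (B j).card = Fintype.card W := fun j => by
    rw [← card_union_of_disjoint (disjoint_left.2 fun v hA hB => (hbipj j).2.1 v ⟨hA, hB⟩),
      ← card_univ]
    congr 1
    ext v
    simpa using (hbipj j).1 v
  have hAcard : ∀ j, 2 * n - 1 ≤ (A j).card := fun j => by
    have := hAB j; have := heqj j; omega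
  have hBcard : ∀ j, 2 * n - 1 ≤ (B j).card := fun j => heqj j ▸ hAcard j
  have hflip : ∀ j, ∀ u v, (Gs j).Adj u v → ((j, u) ∈ V1 ↔ ¬ (j, v) ∈ V1) := fun j u v e =>
    hbip.mem_iff_of_adj ((hlayer j u v).2 e)
  have hconn : ∀ j, ∀ u ∈ A j, ∀ v ∈ B j, Nonempty ((Gs j).Walk u v) := fun j u hu v hv => by
    obtain ⟨k, rfl⟩ : ∃ k, n = k + 2 := ⟨n - 2, by omega⟩
    obtain ⟨s, hs, hsA, rfl⟩ := exists_injective_apply_eq hu (k := k) (by have := hAcard j; omega)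
    obtain ⟨t, ht, htB, rfl⟩ := exists_injective_apply_eq hv (k := k) (by have := hBcard j; omega)
    obtain ⟨P, -⟩ := hpdpc j s t hs ht hsA htB
    exact ⟨P (0 : Fin (k + 1))⟩
  have hside : ∀ j, (∀ v, (j, v) ∈ V1 ↔ v ∈ A j) ∨ ∀ v, (j, v) ∈ V1 ↔ v ∈ B j := fun j =>
    (hbipj j).mem_iff_mem_or (P := fun v => (j, v) ∈ V1) (hflip j) (hconn j)
      (card_pos.1 (by have := hAcard j; omega)) (card_pos.1 (by have := hBcard j; omega))
  refine ⟨fun q v => (q, f v.1 q v.2), ?_, ?_, ?_, ?_, ?_, ?_⟩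
  · intro u v e
    have := hbip.mem_iff_of_adj e
    by_cases h : u ∈ V1 <;> by_cases h' : v ∈ V1 <;> simp_all
  · intros; rfl
  · rintro q ⟨p, v⟩ h
    exact (hf p q h v _).2 rfl
  · rintro q ⟨p, v⟩ h
    have e := ((hf p q h v _).2 rfl).symm
    exact Prod.ext rfl ((hf q p (Ne.symm h) _ _).1 e).symm
  · intro p c F hF
    have key : ∀ C : Finset W, 2 * n - 1 ≤ C.card → ∃ v ∈ C, (p, v) ∉ F := fun C hC => by
      have hlt : F.card < (C.image fun v => (p, v)).card := by
        rw [card_image_of_injective _ (Prod.mk_right_injective p)]; omega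
      obtain ⟨x, hx, hxF⟩ := exists_mem_notMem_of_card_lt_card hlt
      obtain ⟨v, hv, rfl⟩ := mem_image.1 hx
      exact ⟨v, hv, hxF⟩
    obtain ⟨v, hv, hvF⟩ := key _ (hAcard p)
    obtain ⟨w, hw, hwF⟩ := key _ (hBcard p)
    have hvB : v ∉ B p := fun h => (hbipj p).2.1 v ⟨hv, h⟩
    have hwA : w ∉ A p := fun h => (hbipj p).2.1 w ⟨h, hw⟩
    rcases hside p with h | h <;> cases c
    · exact ⟨(p, w), rfl, by simp [h, hwA], hwF⟩
    · exact ⟨(p, v), rfl, by simp [h, hv], hvF⟩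
    · exact ⟨(p, v), rfl, by simp [h, hvB], hvF⟩
    · exact ⟨(p, w), rfl, by simp [h, hw], hwF⟩
  · intro p a b hab ha hb
    obtain ⟨a, rfl⟩ : ∃ a' : Fin (n - 1) → W, a = fun i => (p, a' i) :=
      ⟨fun i => (a i).2, funext fun i => Prod.ext (ha i) rfl⟩
    obtain ⟨b, rfl⟩ : ∃ b' : Fin (n - 1) → W, b = fun i => (p, b' i) :=
      ⟨fun i => (b i).2, funext fun i => Prod.ext (hb i) rfl⟩
    have h := (cover_univ_of_isPDPC (hbipj p) (hpdpc p) (c := fun v => decide ((p, v) ∈ V1))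
      (fun u v huv => by
        rcases hside p with h | h
        · simp only [h, ne_eq, decide_eq_decide] at huv
          tauto
        · simp only [h, ne_eq, decide_eq_decide, (hbipj p).mem_right_iff] at huv
          tauto)
      (a := a) (b := b) ⟨hab.1, fun i hi j hj hij => by
        simpa using hab.2 i hi j hj hij⟩).map (fun w => (p, w)) (Prod.mk_right_injective p)
        fun u v e => (hlayer p u v).2 e
    convert h using 1
    ext ⟨q, w⟩
    simp [eq_comm]

theorem stmt13 {W : Type} [Fintype W] [DecidableEq W] (n ℓ : ℕ) (hn : 3 ≤ n)
    (hℓ : n + 1 ≤ ℓ) (Gs : Fin ℓ → SimpleGraph W)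
    (hcard : 4 * n - 2 ≤ Fintype.card W)
    (A B : Fin ℓ → Finset W)
    (hbipj : ∀ j, IsBipartition (Gs j) (A j) (B j))
    (heqj : ∀ j, (A j).card = (B j).card)
    (hpdpc : ∀ j, ∀ s t : Fin (n - 1) → W, Function.Injective s → Function.Injective t →
      (∀ i, s i ∈ A j) → (∀ i, t i ∈ B j) → IsPDPC (Gs j) s t)
    (G : SimpleGraph (Fin ℓ × W)) (hweld : IsWeld G Gs)
    (V1 V2 : Finset (Fin ℓ × W)) (hbip : IsBipartition G V1 V2)
    (s t : Fin n → Fin ℓ × W) (hs : Function.Injective s) (ht : Function.Injective t)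
    (hsV : ∀ i, s i ∈ V1) (htV : ∀ i, t i ∈ V2) :
    IsPDPC G s t := by
  obtain ⟨mv, H⟩ := hweld.exists_layered (by omega) hcard hbipj heqj hpdpc hbip
  have htV1 : ∀ i, t i ∉ V1 := fun i => hbip.mem_right_iff.1 (htV i)
  refine isPDPC_iff_cover.2 (H.cover_univ hn (by simpa using hℓ) (by simp) ⟨fun i _ => ?_,
    fun i _ j _ hij => ⟨hs.ne hij, ht.ne hij, fun e => htV1 j (e ▸ hsV i)⟩⟩)
  simp [hsV, htV1]
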